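/- arXiv:1708.01916 — 5 statements merged into one kernel-verified Lean document; each statement's English description precedes it below -/
import Mathlib

section
/- Let n ≥ 7 and let G be a connected cograph of order n. Then M_G ≤ (n+1)/2 − (n−1)²/(2·(2^{n−1}+n−1)), with equality if and only if G is isomorphic to the star K_{1,n−1}. -/
open SimpleGraph Finset

/-- The collection of nonempty vertex subsets inducing a connected subgraph. -/
noncomputable def connSets {V : Type*} [Fintype V] (G : SimpleGraph V) : Finset (Finset V) :=
  (Set.toFinite {S : Finset V | S.Nonempty ∧ (G.induce (S : Set V)).Connected}).toFinset

/-- The global mean `M_G`: the average cardinality of the nonempty vertex subsets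
inducing a connected subgraph. -/
noncomputable def globalMean {V : Type*} [Fintype V] (G : SimpleGraph V) : ℝ :=
  (∑ S ∈ connSets G, (S.card : ℝ)) / ((connSets G).card : ℝ)

/-- The collection of vertex subsets containing `v` and inducing a connected subgraph. -/
noncomputable def localSets {V : Type*} [Fintype V] (G : SimpleGraph V) (v : V) :
    Finset (Finset V) :=
  (Set.toFinite {S : Finset V | v ∈ S ∧ (G.induce (S : Set V)).Connected}).toFinset

/-- The local mean `M_{G,v}`: the average cardinality of the vertex subsets containing `v`
and inducing a connected subgraph. -/
noncomputable def localMean {V : Type*} [Fintype V] (G : SimpleGraph V) (v : V) : ℝ :=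
  (∑ S ∈ localSets G v, (S.card : ℝ)) / ((localSets G v).card : ℝ)

/-- The collection of vertex subsets of size at least `2` inducing a connected subgraph. -/
noncomputable def mstarSets {V : Type*} [Fintype V] (G : SimpleGraph V) : Finset (Finset V) :=
  (Set.toFinite {S : Finset V | 2 ≤ S.card ∧ (G.induce (S : Set V)).Connected}).toFinset

/-- The `M*` mean `M*_G`: the average cardinality of the vertex subsets of size at least `2`
inducing a connected subgraph (it equals `0` if there are no such subsets, by the
`0/0 = 0` convention of real division). -/
noncomputable def mstarMean {V : Type*} [Fintype V] (G : SimpleGraph V) : ℝ :=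
  (∑ S ∈ mstarSets G, (S.card : ℝ)) / ((mstarSets G).card : ℝ)

/-- A cograph is a graph with no induced subgraph isomorphic to the path on 4 vertices. -/
def IsCograph {V : Type*} (G : SimpleGraph V) : Prop :=
  IsEmpty (SimpleGraph.pathGraph 4 ↪g G)

/-- The `n`-skillet `S_n = K_1 + (K_1 ∪ K_{n-2})`: vertex `0` is adjacent to all other
vertices, vertex `1` is adjacent only to vertex `0`, and the vertices `2, …, n-1` form a
clique, each also adjacent to vertex `0`. -/
def skillet (n : ℕ) : SimpleGraph (Fin n) :=
  SimpleGraph.fromRel (fun i j => (i : ℕ) = 0 ∨ (2 ≤ (i : ℕ) ∧ 2 ≤ (j : ℕ)))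

open Classical in
/-- Connected subsets of `U` of size at least two. -/
noncomputable def cgF {V : Type*} (G : SimpleGraph V) (U : Finset V) : Finset (Finset V) :=
  U.powerset.filter (fun S => 2 ≤ S.card ∧ (G.induce (S : Set V)).Connected)

lemma cg_mem_F {V : Type*} (G : SimpleGraph V) (U S : Finset V) :
    S ∈ cgF G U ↔ S ⊆ U ∧ 2 ≤ S.card ∧ (G.induce (S : Set V)).Connected := by
  classical
  simp [cgF]

def CgP4 {V : Type*} (G : SimpleGraph V) : Prop :=
  ∀ a b c d : V, G.Adj a b → G.Adj b c → G.Adj c d → ¬ G.Adj a c → ¬ G.Adj a d → ¬ G.Adj b d →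
    a ≠ c → a ≠ d → b ≠ d → False

lemma cg_p4_of_cograph {V : Type*} (G : SimpleGraph V) (h : IsCograph G) : CgP4 G := by
  intro a b c d hab hbc hcd hac had hbd nac nad nbd
  have nab := hab.ne
  have nbc := hbc.ne
  have ncd := hcd.ne
  refine h.false ⟨⟨![a,b,c,d], ?_⟩, ?_⟩
  · intro i j hij
    fin_cases i <;> fin_cases j <;> simp_all
  · intro i j
    change G.Adj (![a, b, c, d] i) (![a, b, c, d] j) ↔ _
    have hba := hab.symm
    have hcb := hbc.symm
    have hdc := hcd.symm
    have hca : ¬ G.Adj c a := fun h => hac h.symm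
    have hda : ¬ G.Adj d a := fun h => had h.symm
    have hdb : ¬ G.Adj d b := fun h => hbd h.symm
    fin_cases i <;> fin_cases j <;> simp_all [SimpleGraph.pathGraph_adj]

lemma cg_p4_compl {V : Type*} (G : SimpleGraph V) (h : CgP4 G) : CgP4 Gᶜ := by
  intro a b c d hab hbc hcd hac had hbd nac nad nbd
  simp only [SimpleGraph.compl_adj, not_and, not_not] at *
  have h1 := hac nac
  have h2 := had nad
  have h3 := hbd nbd
  exact h b d a c h3 h2.symm h1 (fun h => hab.2 h.symm) hbc.2 (fun h => hcd.2 h.symm)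
    hab.1.symm hbc.1 hcd.1.symm

/-- one step of the decomposition -/
lemma cg_step {V : Type*} [DecidableEq V] (G : SimpleGraph V) (h : CgP4 G) (A B : Finset V) (v : V)
    (hA : A.Nonempty) (hB : B.Nonempty) (hAB : Disjoint A B)
    (hvA : v ∉ A) (hvB : v ∉ B) (hno : ∀ x ∈ A, ∀ y ∈ B, ¬ G.Adj x y) :
    ∃ C D : Finset V, C.Nonempty ∧ D.Nonempty ∧ Disjoint C D ∧ C ∪ D = insert v (A ∪ B) ∧
      ((∀ x ∈ C, ∀ y ∈ D, ¬ G.Adj x y) ∨ (∀ x ∈ C, ∀ y ∈ D, G.Adj x y)) := by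
  classical
  have key : ∀ A B : Finset V, A.Nonempty → B.Nonempty → Disjoint A B → v ∉ A → v ∉ B →
      (∀ x ∈ A, ∀ y ∈ B, ¬ G.Adj x y) → (∃ w ∈ A, ¬ G.Adj v w) →
      ∃ C D : Finset V, C.Nonempty ∧ D.Nonempty ∧ Disjoint C D ∧ C ∪ D = insert v (A ∪ B) ∧
      ((∀ x ∈ C, ∀ y ∈ D, ¬ G.Adj x y) ∨ (∀ x ∈ C, ∀ y ∈ D, G.Adj x y)) := by
    intro A B hA hB hAB hvA hvB hno ⟨w, hwA, hvw⟩
    rw [Finset.disjoint_left] at hAB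
    by_cases h1 : ∃ z ∈ B, G.Adj v z
    · obtain ⟨z, hz, hvz⟩ := h1
      by_cases h2 : ∃ x ∈ A, ∃ y ∈ A, G.Adj v x ∧ ¬ G.Adj v y ∧ G.Adj x y
      · obtain ⟨x, hx, y, hy, h3, h4, h5⟩ := h2
        exfalso
        refine h z v x y hvz.symm h3 h5 (fun h => hno x hx z hz h.symm)
          (fun h => hno y hy z hz h.symm) h4 ?_ ?_ ?_
        · rintro rfl; exact hAB hx hz
        · rintro rfl; exact hAB hy hz
        · rintro rfl; exact hvA hy
      · push Not at h2
        refine ⟨A.filter (fun x => ¬ G.Adj v x), insert v (B ∪ A.filter (fun x => G.Adj v x)),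
          ⟨w, by simp [hwA, hvw]⟩, ⟨v, by simp⟩, ?_, ?_, Or.inl ?_⟩
        · rw [Finset.disjoint_left]
          intro x hx hx'
          simp only [Finset.mem_filter, Finset.mem_insert, Finset.mem_union] at hx hx'
          rcases hx' with rfl | hx' | hx'
          · exact hvA hx.1
          · exact hAB hx.1 hx'
          · exact hx.2 hx'.2
        · ext x
          simp only [Finset.mem_filter, Finset.mem_insert, Finset.mem_union]
          tauto
        · intro x hx y hy hxy
          simp only [Finset.mem_filter, Finset.mem_insert, Finset.mem_union] at hx hy
          rcases hy with rfl | hy | hy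
          · exact hx.2 hxy.symm
          · exact hno x hx.1 y hy hxy
          · exact h2 y hy.1 x hx.1 hy.2 hx.2 hxy.symm
    · push Not at h1
      refine ⟨B, insert v A, hB, ⟨v, by simp⟩, ?_, ?_, Or.inl ?_⟩
      · rw [Finset.disjoint_left]
        intro x hx hx'
        rcases Finset.mem_insert.1 hx' with rfl | hx'
        · exact hvB hx
        · exact hAB hx' hx
      · ext x
        simp only [Finset.mem_insert, Finset.mem_union]
        tauto
      · intro x hx y hy hxy
        rcases Finset.mem_insert.1 hy with rfl | hy
        · exact h1 x hx hxy.symm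
        · exact hno y hy x hx hxy.symm
  by_cases hwA : ∃ w ∈ A, ¬ G.Adj v w
  · exact key A B hA hB hAB hvA hvB hno hwA
  by_cases hwB : ∃ w ∈ B, ¬ G.Adj v w
  · obtain ⟨C, D, h1⟩ := key B A hB hA hAB.symm hvB hvA
      (fun x hx y hy hxy => hno y hy x hx hxy.symm) hwB
    rw [Finset.union_comm B A] at h1
    exact ⟨C, D, h1⟩
  push Not at hwA hwB
  refine ⟨{v}, A ∪ B, ⟨v, by simp⟩, ?_, ?_, ?_, Or.inr ?_⟩
  · obtain ⟨x, hx⟩ := hA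
    exact ⟨x, by simp [hx]⟩
  · simp [hvA, hvB]
  · rfl
  · intro x hx y hy
    rw [Finset.mem_singleton] at hx
    subst hx
    rcases Finset.mem_union.1 hy with hy | hy
    · exact hwA y hy
    · exact hwB y hy

lemma cg_split {V : Type*} [DecidableEq V] (G : SimpleGraph V) (h : CgP4 G) (U : Finset V) :
    2 ≤ U.card →
    ∃ C D : Finset V, C.Nonempty ∧ D.Nonempty ∧ Disjoint C D ∧ C ∪ D = U ∧
      ((∀ x ∈ C, ∀ y ∈ D, ¬ G.Adj x y) ∨ (∀ x ∈ C, ∀ y ∈ D, G.Adj x y)) := by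
  classical
  induction U using Finset.induction_on with
  | empty => simp
  | insert v U hv ih =>
    intro hc
    rw [Finset.card_insert_of_notMem hv] at hc
    by_cases h1 : U.card = 1
    · obtain ⟨u, rfl⟩ := Finset.card_eq_one.1 h1
      refine ⟨{v}, {u}, by simp, by simp, by simpa using hv, rfl, ?_⟩
      by_cases huv : G.Adj v u
      · right; simpa using huv
      · left; simpa using huv
    · obtain ⟨A, B, hA, hB, hAB, rfl, h2⟩ := ih (by omega)
      simp only [Finset.mem_union, not_or] at hv
      rcases h2 with h2 | h2
      · exact cg_step G h A B v hA hB hAB hv.1 hv.2 h2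
      · obtain ⟨C, D, hC, hD, hCD, h3, h4⟩ := cg_step Gᶜ (cg_p4_compl G h) A B v hA hB hAB hv.1 hv.2
          (fun x hx y hy hxy => hxy.2 (h2 x hx y hy))
        refine ⟨C, D, hC, hD, hCD, h3, ?_⟩
        have hne : ∀ x ∈ C, ∀ y ∈ D, x ≠ y := fun x hx y hy hxy =>
          Finset.disjoint_left.1 hCD hx (hxy ▸ hy)
        rcases h4 with h4 | h4
        · right
          intro x hx y hy
          by_contra hxy
          exact h4 x hx y hy ⟨hne x hx y hy, hxy⟩
        · left
          intro x hx y hy hxy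
          exact (h4 x hx y hy).2 hxy

/-- connectivity facts -/
lemma cg_conn_no {V : Type*} [DecidableEq V] (G : SimpleGraph V) (A B S : Finset V)
    (hno : ∀ x ∈ A, ∀ y ∈ B, ¬ G.Adj x y) (hS : S ⊆ A ∪ B)
    (hc : (G.induce (S : Set V)).Connected) : S ⊆ A ∨ S ⊆ B := by
  by_contra hcon
  push Not at hcon
  obtain ⟨h1, h2⟩ := hcon
  obtain ⟨x, hxS, hxA⟩ := Finset.not_subset.1 h1
  obtain ⟨y, hyS, hyB⟩ := Finset.not_subset.1 h2
  have hyA : y ∈ A := by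
    rcases Finset.mem_union.1 (hS hyS) with h | h
    · exact h
    · exact absurd h hyB
  have key : ∀ z : (S : Set V), (G.induce (S : Set V)).Reachable ⟨y, hyS⟩ z → (z : V) ∈ A := by
    intro z hz
    rw [SimpleGraph.reachable_iff_reflTransGen] at hz
    induction hz with
    | refl => exact hyA
    | tail _ hbc ih =>
      rename_i b c _
      rcases Finset.mem_union.1 (hS c.2) with h | h
      · exact h
      · exact absurd hbc (hno _ ih _ h)
  exact hxA (key ⟨x, hxS⟩ (hc.preconnected _ _))

lemma cg_conn_all {V : Type*} [DecidableEq V] (G : SimpleGraph V) (A B S : Finset V)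
    (hall : ∀ x ∈ A, ∀ y ∈ B, G.Adj x y) (hS : S ⊆ A ∪ B)
    (h1 : (S ∩ A).Nonempty) (h2 : (S ∩ B).Nonempty) : (G.induce (S : Set V)).Connected := by
  obtain ⟨a, ha⟩ := h1
  obtain ⟨b, hb⟩ := h2
  rw [Finset.mem_inter] at ha hb
  rw [SimpleGraph.connected_iff_exists_forall_reachable]
  refine ⟨⟨a, ha.1⟩, ?_⟩
  have hab : (G.induce (S : Set V)).Adj ⟨a, ha.1⟩ ⟨b, hb.1⟩ := hall a ha.2 b hb.2
  rintro ⟨z, hz⟩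
  rcases Finset.mem_union.1 (hS hz) with h | h
  · have : (G.induce (S : Set V)).Adj ⟨b, hb.1⟩ ⟨z, hz⟩ := (hall z h b hb.2).symm
    exact hab.reachable.trans this.reachable
  · have : (G.induce (S : Set V)).Adj ⟨a, ha.1⟩ ⟨z, hz⟩ := (hall a ha.2 z h)
    exact this.reachable

lemma cg_conn_single {V : Type*} (G : SimpleGraph V) (v : V) :
    (G.induce (({v} : Finset V) : Set V)).Connected := by
  rw [SimpleGraph.connected_iff_exists_forall_reachable]
  refine ⟨⟨v, by simp⟩, ?_⟩
  rintro ⟨z, hz⟩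
  have : z = v := by simpa using hz
  subst this
  exact SimpleGraph.Reachable.refl _

/-- sums -/
lemma cg_sum_card {V : Type*} [DecidableEq V] (A : Finset V) :
    ∑ S ∈ A.powerset, (2 * (S.card : ℝ)) = A.card * 2 ^ A.card := by
  induction A using Finset.induction_on with
  | empty => simp
  | insert v A hv ih =>
    rw [Finset.sum_powerset_insert hv, ih, Finset.card_insert_of_notMem hv]
    have : ∑ t ∈ A.powerset, (2 * ((insert v t).card : ℝ)) = ∑ t ∈ A.powerset, (2 * (t.card : ℝ) + 2) := by
      apply Finset.sum_congr rfl
      intro t ht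
      rw [Finset.card_insert_of_notMem (fun h => hv (Finset.mem_powerset.1 ht h))]
      push_cast; ring
    rw [this, Finset.sum_add_distrib, ih]
    simp
    ring

def cgCross {V : Type*} [DecidableEq V] (A B : Finset V) : Finset (Finset V) :=
  (A ∪ B).powerset.filter (fun S => (S ∩ A).Nonempty ∧ (S ∩ B).Nonempty)

lemma cg_sum_cross {V : Type*} [DecidableEq V] (A B : Finset V) (hAB : Disjoint A B) (c : ℝ) :
    ∑ S ∈ cgCross A B, (c - 2 * (S.card : ℝ)) =
      (c - A.card - B.card) * ((2 ^ A.card - 1) * (2 ^ B.card - 1))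
        - (A.card * (2 ^ B.card - 1) + B.card * (2 ^ A.card - 1)) := by
  have h1 : ∑ S ∈ cgCross A B, (c - 2 * (S.card : ℝ)) =
      ∑ p ∈ (A.powerset.erase ∅) ×ˢ (B.powerset.erase ∅),
        (c - 2 * (p.1.card : ℝ) - 2 * (p.2.card : ℝ)) := by
    have hd := Finset.disjoint_left.1 hAB
    refine Finset.sum_bij' (fun S _ => (S ∩ A, S ∩ B)) (fun p _ => p.1 ∪ p.2) ?_ ?_ ?_ ?_ ?_
    · intro S hS
      simp only [cgCross, Finset.mem_filter, Finset.mem_powerset] at hS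
      simp [hS.2.1.ne_empty, hS.2.2.ne_empty]
    · rintro ⟨P, Q⟩ hp
      simp only [Finset.mem_product, Finset.mem_erase, Finset.mem_powerset] at hp
      obtain ⟨⟨h1, h2⟩, h3, h4⟩ := hp
      simp only [cgCross, Finset.mem_filter, Finset.mem_powerset]
      refine ⟨Finset.union_subset_union h2 h4, ?_, ?_⟩
      · obtain ⟨x, hx⟩ := Finset.nonempty_iff_ne_empty.2 h1
        exact ⟨x, by simp [hx, h2 hx]⟩
      · obtain ⟨x, hx⟩ := Finset.nonempty_iff_ne_empty.2 h3
        exact ⟨x, by simp [hx, h4 hx]⟩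
    · intro S hS
      simp only [cgCross, Finset.mem_filter, Finset.mem_powerset] at hS
      simp only
      rw [← Finset.inter_union_distrib_left]
      exact Finset.inter_eq_left.2 hS.1
    · rintro ⟨P, Q⟩ hp
      simp only [Finset.mem_product, Finset.mem_erase, Finset.mem_powerset] at hp
      obtain ⟨⟨h1, h2⟩, h3, h4⟩ := hp
      ext x
      · simp only [Finset.mem_inter, Finset.mem_union]
        constructor
        · rintro ⟨h | h, h'⟩
          · exact h
          · exact absurd (h4 h) (hd h')
        · intro h; exact ⟨Or.inl h, h2 h⟩
      · simp only [Finset.mem_inter, Finset.mem_union]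
        constructor
        · rintro ⟨h | h, h'⟩
          · exact absurd h' (hd (h2 h))
          · exact h
        · intro h; exact ⟨Or.inr h, h4 h⟩
    · intro S hS
      simp only [cgCross, Finset.mem_filter, Finset.mem_powerset] at hS
      have : S.card = (S ∩ A).card + (S ∩ B).card := by
        rw [← Finset.card_union_of_disjoint, ← Finset.inter_union_distrib_left,
          Finset.inter_eq_left.2 hS.1]
        exact hAB.mono Finset.inter_subset_right Finset.inter_subset_right
      simp only
      rw [this]; push_cast; ring
  have hE : ∀ A : Finset V, ∑ S ∈ A.powerset.erase ∅, (2 * (S.card : ℝ)) = A.card * 2 ^ A.card := by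
    intro A
    rw [← cg_sum_card A, ← Finset.add_sum_erase _ _ (Finset.empty_mem_powerset A)]
    simp
  have hC : ∀ A : Finset V, ((A.powerset.erase ∅).card : ℝ) = 2 ^ A.card - 1 := by
    intro A
    rw [Finset.card_erase_of_mem (Finset.empty_mem_powerset A), Finset.card_powerset,
      Nat.cast_sub Nat.one_le_two_pow]
    push_cast; rfl
  rw [h1, Finset.sum_product]
  simp only [Finset.sum_sub_distrib, Finset.sum_const, nsmul_eq_mul, hE, hC]
  rw [← Finset.mul_sum, hE]
  ring

lemma cg_F_empty {V : Type*} (G : SimpleGraph V) (A : Finset V)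
    (h : ∀ x ∈ A, ∀ y ∈ A, ¬ G.Adj x y) : cgF G A = ∅ := by
  classical
  rw [Finset.eq_empty_iff_forall_notMem]
  intro S hS
  rw [cg_mem_F] at hS
  obtain ⟨h1, h2, h3⟩ := hS
  obtain ⟨x, hx, y, hy, hxy⟩ := Finset.one_lt_card.1 h2
  have := cg_conn_no G {x} (S.erase x) S (fun u hu w hw => h u (h1 (by simp at hu; rwa [hu])) w
    (h1 (Finset.mem_of_mem_erase hw))) (by
      intro z hz; by_cases hzx : z = x <;> simp [hzx, hz]) h3
  rcases this with h | h
  · exact hxy (Finset.mem_singleton.1 (h hy)).symm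
  · simpa using h hx

lemma cg_F_no {V : Type*} [DecidableEq V] (G : SimpleGraph V) (A B : Finset V) (hAB : Disjoint A B)
    (hno : ∀ x ∈ A, ∀ y ∈ B, ¬ G.Adj x y) (f : Finset V → ℝ) :
    ∑ S ∈ cgF G (A ∪ B), f S = ∑ S ∈ cgF G A, f S + ∑ S ∈ cgF G B, f S := by
  have hd : Disjoint (cgF G A) (cgF G B) := by
    rw [Finset.disjoint_left]
    intro S h1 h2
    rw [cg_mem_F] at h1 h2
    have := Finset.disjoint_left.1 hAB
    obtain ⟨x, hx⟩ : S.Nonempty := Finset.card_pos.1 (by omega)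
    exact this (h1.1 hx) (h2.1 hx)
  rw [← Finset.sum_union hd]
  congr 1
  ext S
  simp only [Finset.mem_union, cg_mem_F]
  constructor
  · rintro ⟨h1, h2, h3⟩
    rcases cg_conn_no G A B S hno h1 h3 with h | h
    · exact Or.inl ⟨h, h2, h3⟩
    · exact Or.inr ⟨h, h2, h3⟩
  · rintro (⟨h1, h2⟩ | ⟨h1, h2⟩)
    · exact ⟨h1.trans Finset.subset_union_left, h2⟩
    · exact ⟨h1.trans Finset.subset_union_right, h2⟩

lemma cg_F_all {V : Type*} [DecidableEq V] (G : SimpleGraph V) (A B : Finset V) (hAB : Disjoint A B)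
    (hall : ∀ x ∈ A, ∀ y ∈ B, G.Adj x y) (f : Finset V → ℝ) :
    ∑ S ∈ cgF G (A ∪ B), f S = ∑ S ∈ cgCross A B, f S +
      (∑ S ∈ cgF G A, f S + ∑ S ∈ cgF G B, f S) := by
  have hdis := Finset.disjoint_left.1 hAB
  have hd : Disjoint (cgF G A) (cgF G B) := by
    rw [Finset.disjoint_left]
    intro S h1 h2
    rw [cg_mem_F] at h1 h2
    obtain ⟨x, hx⟩ : S.Nonempty := Finset.card_pos.1 (by omega)
    exact hdis (h1.1 hx) (h2.1 hx)
  have hd2 : Disjoint (cgCross A B) (cgF G A ∪ cgF G B) := by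
    rw [Finset.disjoint_left]
    intro S h1 h2
    simp only [cgCross, Finset.mem_filter, Finset.mem_union, cg_mem_F] at h1 h2
    obtain ⟨_, ⟨x, hx⟩, ⟨y, hy⟩⟩ := h1
    rw [Finset.mem_inter] at hx hy
    rcases h2 with h2 | h2
    · exact hdis (h2.1 hy.1) hy.2
    · exact hdis hx.2 (h2.1 hx.1)
  rw [← Finset.sum_union hd, ← Finset.sum_union hd2]
  congr 1
  ext S
  simp only [Finset.mem_union, cg_mem_F, cgCross, Finset.mem_filter, Finset.mem_powerset]
  constructor
  · rintro ⟨h1, h2, h3⟩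
    by_cases hA : (S ∩ A).Nonempty
    · by_cases hB : (S ∩ B).Nonempty
      · exact Or.inl ⟨h1, hA, hB⟩
      · refine Or.inr (Or.inl ⟨?_, h2, h3⟩)
        intro x hx
        rcases Finset.mem_union.1 (h1 hx) with h | h
        · exact h
        · exact absurd ⟨x, Finset.mem_inter.2 ⟨hx, h⟩⟩ hB
    · refine Or.inr (Or.inr ⟨?_, h2, h3⟩)
      intro x hx
      rcases Finset.mem_union.1 (h1 hx) with h | h
      · exact absurd ⟨x, Finset.mem_inter.2 ⟨hx, h⟩⟩ hA
      · exact h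
  · rintro (⟨h1, h2, h3⟩ | ⟨h1, h2⟩ | ⟨h1, h2⟩)
    · refine ⟨h1, ?_, cg_conn_all G A B S hall h1 h2 h3⟩
      obtain ⟨x, hx⟩ := h2
      obtain ⟨y, hy⟩ := h3
      rw [Finset.mem_inter] at hx hy
      exact Finset.one_lt_card.2 ⟨x, hx.1, y, hy.1, fun h => hdis hx.2 (h ▸ hy.2)⟩
    · exact ⟨h1.trans Finset.subset_union_left, h2⟩
    · exact ⟨h1.trans Finset.subset_union_right, h2⟩

/-- numeric facts -/
lemma cg_pow1 (p : ℕ) : (p : ℝ) ≤ 2 ^ p - 1 := by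
  induction p with
  | zero => simp
  | succ k ih =>
    have : (1 : ℝ) ≤ 2 ^ k := one_le_pow₀ (by norm_num)
    rw [pow_succ]; push_cast; linarith

/-- `p ≤ r (2^p - 1)` from the value at `k` on. -/
lemma cg_pow2 (k : ℕ) (r : ℝ) (hr : 1 ≤ r * 2 ^ k) (hk : (k : ℝ) ≤ r * (2 ^ k - 1)) (p : ℕ) (hp : k ≤ p) :
    (p : ℝ) ≤ r * (2 ^ p - 1) := by
  have hr0 : 0 < r := by
    by_contra h
    push Not at h
    have : r * 2 ^ k ≤ 0 := mul_nonpos_of_nonpos_of_nonneg h (by positivity)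
    linarith
  induction p, hp using Nat.le_induction with
  | base => exact hk
  | succ m hm ih =>
    have : (2 : ℝ) ^ k ≤ 2 ^ m := pow_le_pow_right₀ (by norm_num) hm
    have := mul_le_mul_of_nonneg_left this hr0.le
    rw [pow_succ]; push_cast; linarith

lemma cg_cross_pos (n p q : ℕ) (c : ℝ) (hn : 7 ≤ n) (hp : 1 ≤ p) (hq : 1 ≤ q) (hpq : p + q < n)
    (hc : (n : ℝ) + 1 - 18 / 35 ≤ c) :
    0 < (c - p - q) * ((2 ^ p - 1) * (2 ^ q - 1)) - (p * (2 ^ q - 1) + q * ((2 : ℝ) ^ p - 1)) := by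
  have hx1 := cg_pow1 p
  have hy1 := cg_pow1 q
  have hp' : (1 : ℝ) ≤ p := by exact_mod_cast hp
  have hq' : (1 : ℝ) ≤ q := by exact_mod_cast hq
  have hpq' : (p : ℝ) + q + 1 ≤ n := by exact_mod_cast hpq
  have h2 : p + q + 2 ≤ n ∨ 3 ≤ p ∨ 3 ≤ q := by omega
  have e1 := cg_pow2 3 (3/7) (by norm_num) (by norm_num) p
  have e2 := cg_pow2 3 (3/7) (by norm_num) (by norm_num) q
  generalize (2 : ℝ) ^ p - 1 = x at *
  generalize (2 : ℝ) ^ q - 1 = y at *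
  have hx : 1 ≤ x := by linarith
  have hy : 1 ≤ y := by linarith
  have hxy : 1 ≤ x * y := by nlinarith
  have m1 : p * y ≤ x * y := mul_le_mul_of_nonneg_right hx1 (by linarith)
  have m2 : q * x ≤ x * y := by nlinarith
  rcases h2 with h2 | h2 | h2
  · have : (p : ℝ) + q + 2 ≤ n := by exact_mod_cast h2
    have : 17/7 * (x * y) ≤ (c - p - q) * (x * y) := mul_le_mul_of_nonneg_right (by linarith) (by linarith)
    linarith
  · have e := e1 h2
    have m3 : p * y ≤ 3/7 * x * y := mul_le_mul_of_nonneg_right e (by linarith)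
    have : 52/35 * (x * y) ≤ (c - p - q) * (x * y) := mul_le_mul_of_nonneg_right (by linarith) (by linarith)
    linarith
  · have e := e2 h2
    have m3 : q * x ≤ 3/7 * y * x := mul_le_mul_of_nonneg_right e (by linarith)
    have : 52/35 * (x * y) ≤ (c - p - q) * (x * y) := mul_le_mul_of_nonneg_right (by linarith) (by linarith)
    linarith

lemma cg_E {V : Type*} [DecidableEq V] (G : SimpleGraph V) (h : CgP4 G) (n : ℕ) (hn : 7 ≤ n) (c : ℝ)
    (hc : (n : ℝ) + 1 - 18 / 35 ≤ c) (m : ℕ) : ∀ U : Finset V, U.card = m → m < n →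
    0 ≤ ∑ S ∈ cgF G U, (c - 2 * (S.card : ℝ)) ∧
      ((∃ x ∈ U, ∃ y ∈ U, G.Adj x y) → 0 < ∑ S ∈ cgF G U, (c - 2 * (S.card : ℝ))) := by
  induction m using Nat.strong_induction_on with
  | _ m ih =>
  intro U hU hm
  by_cases h2 : 2 ≤ U.card
  · obtain ⟨A, B, hA, hB, hAB, rfl, h3⟩ := cg_split G h U h2
    have hcA := hA.card_pos
    have hcB := hB.card_pos
    rw [Finset.card_union_of_disjoint hAB] at hU
    have iA := ih A.card (by omega) A rfl (by omega)
    have iB := ih B.card (by omega) B rfl (by omega)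
    rcases h3 with h3 | h3
    · rw [cg_F_no G A B hAB h3]
      refine ⟨by linarith [iA.1, iB.1], ?_⟩
      rintro ⟨x, hx, y, hy, hxy⟩
      rcases Finset.mem_union.1 hx with hx | hx <;> rcases Finset.mem_union.1 hy with hy | hy
      · linarith [iA.2 ⟨x, hx, y, hy, hxy⟩, iB.1]
      · exact absurd hxy (h3 x hx y hy)
      · exact absurd hxy.symm (h3 y hy x hx)
      · linarith [iB.2 ⟨x, hx, y, hy, hxy⟩, iA.1]
    · rw [cg_F_all G A B hAB h3, cg_sum_cross A B hAB c]
      have := cg_cross_pos n A.card B.card c hn hcA hcB (by omega) hc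
      exact ⟨by linarith [iA.1, iB.1], fun _ => by linarith [iA.1, iB.1]⟩
  · have hle : U.card ≤ 1 := by omega
    rw [Finset.card_le_one] at hle
    have hno : ∀ x ∈ U, ∀ y ∈ U, ¬ G.Adj x y := fun x hx y hy hxy => hxy.ne (hle x hx y hy)
    rw [cg_F_empty G U hno]
    refine ⟨by simp, ?_⟩
    rintro ⟨x, hx, y, hy, hxy⟩
    exact absurd hxy (hno x hx y hy)

lemma cg_delta (n k : ℕ) (r : ℝ) (hk : 1 ≤ k) (hk' : 3 ≤ k) (hr1 : 0 < r)
    (h0 : ((k : ℝ) - 1) ^ 2 ≤ r * (2 ^ (k - 1) + (k : ℝ) - 1))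
    (h1 : 2 * (k : ℝ) - 1 ≤ r * (2 ^ (k - 1) + 1)) (h2 : 2 ≤ r * 2 ^ (k - 1)) (hn : k ≤ n) :
    ((n : ℝ) - 1) ^ 2 / (2 ^ (n - 1) + (n : ℝ) - 1) ≤ r := by
  have key : ((n : ℝ) - 1) ^ 2 ≤ r * (2 ^ (n - 1) + (n : ℝ) - 1) ∧
      2 * (n : ℝ) - 1 ≤ r * (2 ^ (n - 1) + 1) ∧ 2 ≤ r * 2 ^ (n - 1) := by
    induction n, hn using Nat.le_induction with
    | base => exact ⟨h0, h1, h2⟩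
    | succ m hm ih =>
      obtain ⟨i0, i1, i2⟩ := ih
      have : m + 1 - 1 = (m - 1) + 1 := by omega
      rw [this, pow_succ (2 : ℝ)]
      push_cast
      refine ⟨by nlinarith, by nlinarith, by nlinarith⟩
  have hn1 : (1 : ℝ) ≤ n := by exact_mod_cast hk.trans hn
  have hp : (0 : ℝ) < 2 ^ (n - 1) := by positivity
  rw [div_le_iff₀ (by linarith)]
  exact key.1

lemma cg_final (a b : ℕ) (d : ℝ) (ha : 2 ≤ a) (hb : 2 ≤ b) (hab : b ≤ a) (hn : 7 ≤ a + b)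
    (hd : d = (((a + b : ℕ) : ℝ) - 1) ^ 2 / (2 ^ ((a + b) - 1) + ((a + b : ℕ) : ℝ) - 1)) :
    0 < ((((a + b : ℕ) : ℝ) + 1 - d) - a - b) * ((2 ^ a - 1) * (2 ^ b - 1))
      - (a * (2 ^ b - 1) + b * ((2 : ℝ) ^ a - 1)) +
      (a + b : ℕ) * ((((a + b : ℕ) : ℝ) + 1 - d) - 2) := by
  by_cases h9 : 9 ≤ a + b
  · have hd4 : d ≤ 1 / 4 := by
      rw [hd]
      exact cg_delta (a + b) 9 (1/4) (by norm_num) (by norm_num) (by norm_num) (by norm_num)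
        (by norm_num) (by norm_num) h9
    have h3 : (b = 2 ∧ 7 ≤ a) ∨ (3 ≤ b ∧ 5 ≤ a) := by omega
    have hx1 := cg_pow1 a
    have hy1 := cg_pow1 b
    have a1 := cg_pow2 7 (7/127) (by norm_num) (by norm_num) a
    have a2 := cg_pow2 5 (5/31) (by norm_num) (by norm_num) a
    have b1 := cg_pow2 2 (2/3) (by norm_num) (by norm_num) b hb
    have b2 := cg_pow2 3 (3/7) (by norm_num) (by norm_num) b
    have ha' : (2 : ℝ) ≤ a := by exact_mod_cast ha
    have hb' : (2 : ℝ) ≤ b := by exact_mod_cast hb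
    push_cast
    clear hd
    generalize (2 : ℝ) ^ a - 1 = x at *
    generalize (2 : ℝ) ^ b - 1 = y at *
    have hx : 0 < x := by linarith
    have hy : 0 < y := by linarith
    have hxy : 0 < x * y := by positivity
    have t1 : 0 < ((a : ℝ) + b) * ((a : ℝ) + b + 1 - d - 2) := by
      apply mul_pos <;> linarith
    have t2 : 3/4 * (x * y) ≤ ((a : ℝ) + b + 1 - d - a - b) * (x * y) :=
      mul_le_mul_of_nonneg_right (by linarith) hxy.le
    rcases h3 with ⟨_, h3⟩ | ⟨h3, h4⟩
    · have m1 : a * y ≤ 7/127 * x * y := mul_le_mul_of_nonneg_right (a1 h3) hy.le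
      have m2 : b * x ≤ 2/3 * y * x := mul_le_mul_of_nonneg_right b1 hx.le
      linarith
    · have m1 : a * y ≤ 5/31 * x * y := mul_le_mul_of_nonneg_right (a2 h4) hy.le
      have m2 : b * x ≤ 3/7 * y * x := mul_le_mul_of_nonneg_right (b2 h3) hx.le
      linarith
  · have h3 : (a = 5 ∧ b = 2) ∨ (a = 4 ∧ b = 3) ∨ (a = 6 ∧ b = 2) ∨ (a = 5 ∧ b = 3) ∨
      (a = 4 ∧ b = 4) := by omega
    rcases h3 with ⟨rfl, rfl⟩ | ⟨rfl, rfl⟩ | ⟨rfl, rfl⟩ | ⟨rfl, rfl⟩ | ⟨rfl, rfl⟩ <;>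
      rw [hd] <;> norm_num

lemma cg_star_num (a : ℕ) (d : ℝ) (hn : 1 ≤ a)
    (hd : d = (((a + 1 : ℕ) : ℝ) - 1) ^ 2 / (2 ^ ((a + 1) - 1) + ((a + 1 : ℕ) : ℝ) - 1)) :
    ((((a + 1 : ℕ) : ℝ) + 1 - d) - a - 1) * ((2 ^ a - 1) * (2 ^ 1 - 1))
      - (a * (2 ^ 1 - 1) + 1 * ((2 : ℝ) ^ a - 1)) +
      (a + 1 : ℕ) * ((((a + 1 : ℕ) : ℝ) + 1 - d) - 2) = 0 := by
  have hp : (0 : ℝ) < 2 ^ a + a := by positivity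
  have : d * (2 ^ a + a) = (a : ℝ) ^ 2 := by
    rw [hd]; push_cast
    have : (2 : ℝ) ^ a + (a + 1) - 1 = 2 ^ a + a := by ring
    rw [this, add_sub_cancel_right]
    field_simp
  push_cast
  linear_combination (-1) * this

lemma cg_total {V : Type*} [Fintype V] (G : SimpleGraph V) (c : ℝ) :
    ∑ S ∈ connSets G, (c - 2 * (S.card : ℝ)) =
      Fintype.card V * (c - 2) + ∑ S ∈ cgF G Finset.univ, (c - 2 * (S.card : ℝ)) := by
  classical
  have h : connSets G = (Finset.univ.image (fun v : V => ({v} : Finset V))) ∪ cgF G Finset.univ := by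
    ext S
    simp only [connSets, Set.Finite.mem_toFinset, Set.mem_ofPred_eq, Finset.mem_union,
      Finset.mem_image, Finset.mem_univ, true_and, cg_mem_F, Finset.subset_univ]
    constructor
    · rintro ⟨h1, h2⟩
      by_cases h3 : 2 ≤ S.card
      · exact Or.inr ⟨h3, h2⟩
      · have := h1.card_pos
        obtain ⟨v, rfl⟩ := Finset.card_eq_one.1 (show S.card = 1 by omega)
        exact Or.inl ⟨v, rfl⟩
    · rintro (⟨v, rfl⟩ | ⟨h1, h2⟩)
      · exact ⟨by simp, cg_conn_single G v⟩
      · exact ⟨Finset.card_pos.1 (by omega), h2⟩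
  rw [h, Finset.sum_union, Finset.sum_image]
  · simp [mul_sub]
  · intro x _ y _ hxy
    simpa using hxy
  · rw [Finset.disjoint_left]
    intro S h1 h2
    rw [cg_mem_F] at h2
    obtain ⟨v, _, rfl⟩ := Finset.mem_image.1 h1
    simp at h2

lemma cg_total_join {V : Type*} [Fintype V] [DecidableEq V] (G : SimpleGraph V) (c : ℝ)
    (A B : Finset V) (hAB : Disjoint A B) (hU : A ∪ B = Finset.univ)
    (hall : ∀ x ∈ A, ∀ y ∈ B, G.Adj x y) :
    ∑ S ∈ connSets G, (c - 2 * (S.card : ℝ)) =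
      ((c - A.card - B.card) * ((2 ^ A.card - 1) * (2 ^ B.card - 1))
        - (A.card * (2 ^ B.card - 1) + B.card * (2 ^ A.card - 1))
        + Fintype.card V * (c - 2)) + ((∑ S ∈ cgF G A, (c - 2 * (S.card : ℝ))) +
        ∑ S ∈ cgF G B, (c - 2 * (S.card : ℝ))) := by
  rw [cg_total, ← hU, cg_F_all G A B hAB hall, cg_sum_cross A B hAB c]
  ring

/-- star from a partition -/
lemma cg_star_of {V : Type*} [Fintype V] [DecidableEq V] (G : SimpleGraph V) (n : ℕ)
    (hcard : Fintype.card V = n) (v : V) (h1 : ∀ x, x ≠ v → G.Adj v x)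
    (h2 : ∀ x, x ≠ v → ∀ y, y ≠ v → ¬ G.Adj x y) :
    Nonempty (G ≃g completeBipartiteGraph (Fin 1) (Fin (n - 1))) := by
  have e1 : {x : V // x = v} ≃ Fin 1 := Fintype.equivOfCardEq (by simp)
  have e2 : {x : V // ¬ x = v} ≃ Fin (n - 1) := Fintype.equivOfCardEq (by
    rw [Fintype.card_subtype_compl]; simp [hcard])
  let e : V ≃ Fin 1 ⊕ Fin (n - 1) :=
    (Equiv.sumCompl (fun x => x = v)).symm.trans (Equiv.sumCongr e1 e2)
  have hl : ∀ x, (e x).isLeft = true ↔ x = v := by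
    intro x
    by_cases hx : x = v
    · have : (Equiv.sumCompl (fun x => x = v)).symm x = Sum.inl ⟨x, hx⟩ := by
        rw [Equiv.symm_apply_eq]; rfl
      simp [e, this, hx]
    · have : (Equiv.sumCompl (fun x => x = v)).symm x = Sum.inr ⟨x, hx⟩ := by
        rw [Equiv.symm_apply_eq]; rfl
      simp [e, this, hx]
  have hr : ∀ x, (e x).isRight = true ↔ x ≠ v := by
    intro x
    rw [ne_eq, ← hl x]
    cases e x <;> simp
  refine ⟨⟨e, ?_⟩⟩
  intro x y
  change ((e x).isLeft ∧ (e y).isRight ∨ (e x).isRight ∧ (e y).isLeft) ↔ _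
  rw [hl, hl, hr, hr]
  constructor
  · rintro (⟨rfl, h⟩ | ⟨h, rfl⟩)
    · exact h1 y h
    · exact (h1 x h).symm
  · intro h
    by_cases hx : x = v
    · exact Or.inl ⟨hx, fun hy => h.ne (hx.trans hy.symm)⟩
    · by_cases hy : y = v
      · exact Or.inr ⟨hx, hy⟩
      · exact absurd h (h2 x hx y hy)

lemma cg_of_star {V : Type*} [Fintype V] (G : SimpleGraph V) (n : ℕ)
    (e : G ≃g completeBipartiteGraph (Fin 1) (Fin (n - 1))) :
    ∃ v : V, (∀ x, x ≠ v → G.Adj x v) ∧ (∀ x, x ≠ v → ∀ y, y ≠ v → ¬ G.Adj x y) := by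
  refine ⟨e.symm (Sum.inl 0), ?_⟩
  have hr : ∀ x, x ≠ e.symm (Sum.inl 0) → ∃ i, e x = Sum.inr i := by
    intro x hx
    cases h : e x with
    | inl i =>
      exfalso; apply hx
      rw [← Subsingleton.elim i 0, ← h]; simp
    | inr i => exact ⟨i, rfl⟩
  constructor
  · intro x hx
    obtain ⟨i, hi⟩ := hr x hx
    rw [← e.map_adj_iff, hi, RelIso.apply_symm_apply]
    simp [completeBipartiteGraph]
  · intro x hx y hy
    obtain ⟨i, hi⟩ := hr x hx
    obtain ⟨j, hj⟩ := hr y hy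
    rw [← e.map_adj_iff, hi, hj]
    simp [completeBipartiteGraph]

lemma cg_star_total {V : Type*} [Fintype V] [DecidableEq V] (G : SimpleGraph V) (n : ℕ) (hn : 7 ≤ n)
    (hcard : Fintype.card V = n) (v : V) (h1 : ∀ x, x ≠ v → G.Adj x v) (d : ℝ)
    (hd : d = ((n : ℝ) - 1) ^ 2 / (2 ^ (n - 1) + (n : ℝ) - 1)) :
    ∑ S ∈ connSets G, (((n : ℝ) + 1 - d) - 2 * (S.card : ℝ)) =
      ∑ S ∈ cgF G (Finset.univ.erase v), (((n : ℝ) + 1 - d) - 2 * (S.card : ℝ)) := by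
  have hB : cgF G {v} = ∅ := cg_F_empty G {v} (by
    intro x hx y hy hxy
    rw [Finset.mem_singleton] at hx hy
    exact hxy.ne (hx.trans hy.symm))
  rw [cg_total_join G _ (Finset.univ.erase v) {v} (by simp) (by ext x; by_cases h : x = v <;> simp [h])
    (by
      intro x hx y hy
      rw [Finset.mem_singleton] at hy
      subst hy
      exact h1 x (Finset.ne_of_mem_erase hx)), hB]
  obtain ⟨a, rfl⟩ : ∃ a, n = a + 1 := ⟨n - 1, by omega⟩
  have hc : (Finset.univ.erase v).card = a := by
    rw [Finset.card_erase_of_mem (Finset.mem_univ v), Finset.card_univ, hcard]; rfl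
  have := cg_star_num a d (by omega) hd
  rw [hc, hcard, Finset.card_singleton, Nat.cast_one, this]
  simp

lemma cg_main {V : Type*} [Fintype V] (G : SimpleGraph V) (n : ℕ) (hn : 7 ≤ n)
    (hcard : Fintype.card V = n) (hcog : IsCograph G) (hconn : G.Connected) (d : ℝ)
    (hd : d = ((n : ℝ) - 1) ^ 2 / (2 ^ (n - 1) + (n : ℝ) - 1)) :
    0 ≤ ∑ S ∈ connSets G, (((n : ℝ) + 1 - d) - 2 * (S.card : ℝ)) ∧
    (∑ S ∈ connSets G, (((n : ℝ) + 1 - d) - 2 * (S.card : ℝ)) = 0 ↔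
      Nonempty (G ≃g completeBipartiteGraph (Fin 1) (Fin (n - 1)))) := by
  classical
  have hp4 := cg_p4_of_cograph G hcog
  have hd1 : d ≤ 18 / 35 := by
    rw [hd]
    exact cg_delta n 7 (18/35) (by norm_num) (by norm_num) (by norm_num) (by norm_num)
        (by norm_num) (by norm_num) hn
  have hstar : Nonempty (G ≃g completeBipartiteGraph (Fin 1) (Fin (n - 1))) →
      ∑ S ∈ connSets G, (((n : ℝ) + 1 - d) - 2 * (S.card : ℝ)) = 0 := by
    rintro ⟨e⟩
    obtain ⟨v, h1, h2⟩ := cg_of_star G n e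
    rw [cg_star_total G n hn hcard v h1 d hd, cg_F_empty]
    · simp
    · intro x hx y hy
      exact h2 x (Finset.ne_of_mem_erase hx) y (Finset.ne_of_mem_erase hy)
  have hE := fun U : Finset V => cg_E G hp4 n hn ((n : ℝ) + 1 - d) (by linarith) U.card U rfl
  -- universal vertex case
  have huniv : (∃ v : V, ∀ x, x ≠ v → G.Adj x v) →
      0 ≤ ∑ S ∈ connSets G, (((n : ℝ) + 1 - d) - 2 * (S.card : ℝ)) ∧
      (∑ S ∈ connSets G, (((n : ℝ) + 1 - d) - 2 * (S.card : ℝ)) = 0 →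
        Nonempty (G ≃g completeBipartiteGraph (Fin 1) (Fin (n - 1)))) := by
    rintro ⟨v, hv⟩
    rw [cg_star_total G n hn hcard v hv d hd]
    have := hE (Finset.univ.erase v) (by
      rw [Finset.card_erase_of_mem (Finset.mem_univ v), Finset.card_univ, hcard]; omega)
    refine ⟨this.1, fun h0 => ?_⟩
    refine cg_star_of G n hcard v (fun x hx => (hv x hx).symm) ?_
    intro x hx y hy hxy
    exact (this.2 ⟨x, by simp [hx], y, by simp [hy], hxy⟩).ne' h0
  suffices hs : 0 ≤ ∑ S ∈ connSets G, (((n : ℝ) + 1 - d) - 2 * (S.card : ℝ)) ∧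
      (∑ S ∈ connSets G, (((n : ℝ) + 1 - d) - 2 * (S.card : ℝ)) = 0 →
        Nonempty (G ≃g completeBipartiteGraph (Fin 1) (Fin (n - 1)))) from
    ⟨hs.1, hs.2, hstar⟩
  by_cases hu : ∃ v : V, ∀ x, x ≠ v → G.Adj x v
  · exact huniv hu
  have hcu : (Finset.univ : Finset V).card = n := by rw [Finset.card_univ, hcard]
  -- the other case, with a wlog on sizes
  have key : ∀ A B : Finset V, A.Nonempty → B.Nonempty → Disjoint A B → A ∪ B = Finset.univ →
      (∀ x ∈ A, ∀ y ∈ B, G.Adj x y) → B.card ≤ A.card →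
      0 < ∑ S ∈ connSets G, (((n : ℝ) + 1 - d) - 2 * (S.card : ℝ)) := by
    intro A B hA hB hAB hU hall hle
    have hsum : A.card + B.card = n := by rw [← Finset.card_union_of_disjoint hAB, hU, hcu]
    have hb1 := hB.card_pos
    have hb : 2 ≤ B.card := by
      by_contra hb
      obtain ⟨v, rfl⟩ := Finset.card_eq_one.1 (show B.card = 1 by omega)
      apply hu
      refine ⟨v, fun x hx => hall x ?_ v (by simp)⟩
      have : x ∈ A ∪ {v} := by rw [hU]; exact Finset.mem_univ x
      simpa [hx] using this
    rw [cg_total_join G _ A B hAB hU hall, hcard]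
    have f1 := hE A (by omega)
    have f2 := hE B (by omega)
    have f3 := cg_final A.card B.card d (by omega) hb hle (by omega) (by rw [hsum]; exact hd)
    rw [hsum] at f3
    linarith [f1.1, f2.1]
  obtain ⟨A, B, hA, hB, hAB, hU, h3⟩ := cg_split G hp4 Finset.univ (by rw [hcu]; omega)
  have hpos : 0 < ∑ S ∈ connSets G, (((n : ℝ) + 1 - d) - 2 * (S.card : ℝ)) := by
    rcases h3 with h3 | h3
    · exfalso
      have hc : (G.induce ((Finset.univ : Finset V) : Set V)).Connected := by
        rw [Finset.coe_univ]
        exact (SimpleGraph.induceUnivIso G).connected_iff.2 hconn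
      have hd' := Finset.disjoint_left.1 hAB
      obtain ⟨x, hx⟩ := hA
      obtain ⟨y, hy⟩ := hB
      rcases cg_conn_no G A B Finset.univ h3 hU.ge hc with h | h
      · exact hd' (h (Finset.mem_univ y)) hy
      · exact hd' hx (h (Finset.mem_univ x))
    · rcases le_total B.card A.card with h | h
      · exact key A B hA hB hAB hU h3 h
      · exact key B A hB hA hAB.symm (by rw [Finset.union_comm, hU])
          (fun x hx y hy => (h3 y hy x hx).symm) h
  exact ⟨hpos.le, fun h => absurd h hpos.ne'⟩

theorem stmt_0 {V : Type*} [Fintype V] (G : SimpleGraph V) (n : ℕ) (hn : 7 ≤ n)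
    (hcard : Fintype.card V = n) (hcog : IsCograph G) (hconn : G.Connected) :
    globalMean G ≤ ((n : ℝ) + 1) / 2 - ((n : ℝ) - 1) ^ 2 / (2 * (2 ^ (n - 1) + (n : ℝ) - 1)) ∧
      (globalMean G = ((n : ℝ) + 1) / 2 - ((n : ℝ) - 1) ^ 2 / (2 * (2 ^ (n - 1) + (n : ℝ) - 1)) ↔
        Nonempty (G ≃g completeBipartiteGraph (Fin 1) (Fin (n - 1)))) := by
  obtain ⟨m1, m2⟩ := cg_main G n hn hcard hcog hconn _ rfl
  rw [← m2]
  have hpos : (0 : ℝ) < ((connSets G).card : ℝ) := by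
    have hne : Nonempty V := hconn.nonempty
    obtain ⟨v⟩ := hne
    have : (connSets G).Nonempty := ⟨{v}, by
      simp only [connSets, Set.Finite.mem_toFinset, Set.mem_ofPred_eq]
      exact ⟨by simp, cg_conn_single G v⟩⟩
    exact_mod_cast this.card_pos
  have hr : ((n : ℝ) - 1) ^ 2 / (2 * (2 ^ (n - 1) + (n : ℝ) - 1)) =
      ((n : ℝ) - 1) ^ 2 / (2 ^ (n - 1) + (n : ℝ) - 1) / 2 := by
    rw [mul_comm, div_div]
  rw [hr]
  generalize ((n : ℝ) - 1) ^ 2 / (2 ^ (n - 1) + (n : ℝ) - 1) = d at *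
  rw [Finset.sum_sub_distrib, ← Finset.mul_sum, Finset.sum_const, nsmul_eq_mul] at *
  unfold globalMean
  generalize ∑ S ∈ connSets G, (S.card : ℝ) = s at *
  rw [div_le_iff₀ hpos, div_eq_iff hpos.ne']
  refine ⟨by linarith, ?_, ?_⟩ <;> intro h <;> linarith
end

section
/- Let G be a connected cograph of order n ≥ 1. Then M_G ≤ (n+1)/2, with equality if and only if n = 1. -/
open SimpleGraph Finset

def P4Free {V : Type*} (G : SimpleGraph V) : Prop :=
  ∀ a b c d, G.Adj a b → G.Adj b c → G.Adj c d → a ≠ c → a ≠ d → b ≠ d →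
    ¬ G.Adj a c → ¬ G.Adj b d → ¬ G.Adj a d → False

lemma P4Free.compl {V : Type*} {G : SimpleGraph V} (h : P4Free G) : P4Free Gᶜ := by
  intro a b c d hab hbc hcd hac had hbd nac nbd nad
  simp only [compl_adj, not_and, not_not] at *
  exact h c a d b (nac hac).symm (nad had) (nbd hbd).symm hcd.1 hbc.1.symm hab.1 hcd.2 hab.2
    (fun h => hbc.2 h.symm)

lemma IsCograph.p4free {V : Type*} {G : SimpleGraph V} (h : IsCograph G) : P4Free G := by
  intro a b c d hab hbc hcd hac had hbd nac nbd nad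
  have h1 := hab.ne
  have h2 := hbc.ne
  have h3 := hcd.ne
  refine h.false ⟨⟨![a, b, c, d], ?_⟩, ?_⟩
  · intro i j hij
    fin_cases i <;> fin_cases j <;> simp_all
  · intro i j
    change G.Adj (![a, b, c, d] i) (![a, b, c, d] j) ↔ _
    rw [pathGraph_adj]
    fin_cases i <;> fin_cases j <;> simp_all [G.adj_comm]

def Split {V : Type*} [DecidableEq V] (G : SimpleGraph V) (U : Finset V) : Prop :=
  ∃ A B : Finset V, A ∪ B = U ∧ Disjoint A B ∧ A.Nonempty ∧ B.Nonempty ∧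
    ∀ a ∈ A, ∀ b ∈ B, ¬ G.Adj a b

lemma split_step {V : Type*} [DecidableEq V] {G : SimpleGraph V} (h : P4Free G)
    (U : Finset V) (v : V) (hv : v ∉ U) (hU : Split G U) :
    Split G (insert v U) ∨ Split Gᶜ (insert v U) := by
  classical
  by_cases hall : ∀ u ∈ U, G.Adj v u
  · right
    obtain ⟨A, B, hAB, hd, hA, hB, hn⟩ := hU
    refine ⟨{v}, U, by ext; simp, by simpa using hv, by simp, ?_, ?_⟩
    · obtain ⟨x, hx⟩ := hA
      exact ⟨x, by rw [← hAB]; simp [hx]⟩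
    · intro a ha b hb
      simp only [mem_singleton] at ha
      subst ha
      simp [hall b hb]
  left
  push Not at hall
  obtain ⟨u, huU, hvu⟩ := hall
  let R : V → V → Prop := fun x y => G.Adj x y ∧ y ∈ U
  let C := U.filter (fun w => Relation.ReflTransGen R u w)
  have hCU : C ⊆ U := filter_subset _ _
  have huC : u ∈ C := by simp [C, huU, Relation.ReflTransGen.refl]
  have hclosed : ∀ x ∈ C, ∀ y ∈ U, G.Adj x y → y ∈ C := by
    intro x hx y hy hxy
    simp only [C, mem_filter] at hx ⊢
    exact ⟨hy, hx.2.tail ⟨hxy, hy⟩⟩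
  have hne : (U \ C).Nonempty := by
    obtain ⟨A, B, hAB, hd, hA, hB, hn⟩ := hU
    have key : ∀ A' : Finset V, u ∈ A' → (∀ x ∈ A', ∀ y ∈ U, G.Adj x y → y ∈ A') → C ⊆ A' := by
      intro A' hu' hcl w hw
      simp only [C, mem_filter] at hw
      have := hw.2
      induction this with
      | refl => exact hu'
      | tail h1 h2 ih =>
        rename_i y z
        by_cases hy : y ∈ U
        · exact hcl y (ih ⟨hy, h1⟩) z h2.2 h2.1
        · exfalso
          cases h1 with
          | refl => exact hy huU
          | tail _ h3 => exact hy h3.2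
    rw [← hAB] at huU
    rcases mem_union.1 huU with hu | hu
    · have := key A hu (fun x hx y hy hxy => by
        rw [← hAB] at hy
        rcases mem_union.1 hy with hy | hy
        · exact hy
        · exact absurd hxy (hn x hx y hy))
      obtain ⟨b, hb⟩ := hB
      refine ⟨b, mem_sdiff.2 ⟨by rw [← hAB]; simp [hb], fun hbC => ?_⟩⟩
      exact (Finset.disjoint_left.1 hd (this hbC)) hb
    · have := key B hu (fun x hx y hy hxy => by
        rw [← hAB] at hy
        rcases mem_union.1 hy with hy | hy
        · exact absurd hxy.symm (hn y hy x hx)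
        · exact hy)
      obtain ⟨b, hb⟩ := hA
      refine ⟨b, mem_sdiff.2 ⟨by rw [← hAB]; simp [hb], fun hbC => ?_⟩⟩
      exact (Finset.disjoint_left.1 hd hb) (this hbC)
  by_cases hvC : ∃ w ∈ C, G.Adj v w
  · obtain ⟨w, hwC, hvw⟩ := hvC
    have hxy : ∃ x ∈ C, ∃ y ∈ C, G.Adj x y ∧ G.Adj v x ∧ ¬ G.Adj v y := by
      by_contra hcon
      push Not at hcon
      have : ∀ w, Relation.ReflTransGen R u w → w ∈ C ∧ ¬ G.Adj v w := by
        intro w hw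
        induction hw with
        | refl => exact ⟨huC, hvu⟩
        | tail h1 h2 ih =>
          rename_i y z
          have hz := hclosed y ih.1 z h2.2 h2.1
          exact ⟨hz, fun hvz => ih.2 (hcon z hz y ih.1 h2.1.symm hvz)⟩
      exact (this w (mem_filter.1 hwC).2).2 hvw
    obtain ⟨x, hx, y, hy, hadj, hvx, hvy⟩ := hxy
    refine ⟨insert v C, U \ C, ?_, ?_, by simp, hne, ?_⟩
    · ext z; by_cases hz : z ∈ C
      · simp [hz, hCU hz]
      · simp [hz]
    · rw [Finset.disjoint_left]
      intro z hz hz'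
      simp only [mem_insert, mem_sdiff] at hz hz'
      rcases hz with rfl | hz
      · exact hv hz'.1
      · exact hz'.2 hz
    · intro a ha b hb hab
      simp only [mem_insert, mem_sdiff] at ha hb
      rcases ha with rfl | ha
      · have hxb : ¬ G.Adj x b := fun h' => hb.2 (hclosed x hx b hb.1 h')
        have hyb : ¬ G.Adj y b := fun h' => hb.2 (hclosed y hy b hb.1 h')
        refine h y x a b hadj.symm hvx.symm hab ?_ ?_ ?_ (fun h' => hvy h'.symm) hxb hyb
        · rintro rfl; exact hv (hCU hy)
        · rintro rfl; exact hb.2 hy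
        · rintro rfl; exact hb.2 hx
      · exact hb.2 (hclosed a ha b hb.1 hab)
  · push Not at hvC
    refine ⟨insert v (U \ C), C, ?_, ?_, by simp, ⟨u, huC⟩, ?_⟩
    · ext z; by_cases hz : z ∈ C
      · simp [hz, hCU hz]
      · simp [hz]
    · rw [Finset.disjoint_left]
      intro z hz hz'
      simp only [mem_insert, mem_sdiff] at hz
      rcases hz with rfl | hz
      · exact hv (hCU hz')
      · exact hz.2 hz'
    · intro a ha b hb hab
      simp only [mem_insert, mem_sdiff] at ha
      rcases ha with rfl | ha
      · exact hvC b hb hab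
      · exact ha.2 (hclosed b hb a ha.1 hab.symm)

lemma split_exists {V : Type*} [DecidableEq V] {G : SimpleGraph V} (h : P4Free G)
    (U : Finset V) : 2 ≤ U.card → Split G U ∨ Split Gᶜ U := by
  induction U using Finset.induction_on with
  | empty => simp
  | insert v U hv ih =>
    intro hc
    rw [card_insert_of_notMem hv] at hc
    by_cases h2 : 2 ≤ U.card
    · rcases ih h2 with h1 | h1
      · exact split_step h U v hv h1
      · have := split_step h.compl U v hv h1
        rw [compl_compl] at this
        exact this.symm
    · have : U.card = 1 := by omega
      obtain ⟨u, rfl⟩ := card_eq_one.1 this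
      have hvu : v ≠ u := by simpa using hv
      by_cases hadj : G.Adj v u
      · right
        exact ⟨{v}, {u}, by ext; simp, by simpa using hvu, by simp, by simp, by simp [hadj]⟩
      · left
        exact ⟨{v}, {u}, by ext; simp, by simpa using hvu, by simp, by simp, by simp [hadj]⟩

def Cn {V : Type*} (G : SimpleGraph V) (S : Finset V) : Prop :=
  S.Nonempty ∧ (G.induce (S : Set V)).Connected

lemma cn_singleton {V : Type*} (G : SimpleGraph V) (v : V) : Cn G {v} := by
  refine ⟨by simp, ?_⟩
  have : Subsingleton ((({v} : Finset V) : Set V)) := by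
    rw [Finset.coe_singleton]; infer_instance
  have : Nonempty ((({v} : Finset V) : Set V)) := ⟨⟨v, by simp⟩⟩
  exact ⟨Preconnected.of_subsingleton⟩

lemma not_cn {V : Type*} [DecidableEq V] (G : SimpleGraph V) (A B S : Finset V)
    (hn : ∀ a ∈ A, ∀ b ∈ B, ¬ G.Adj a b) (hS : S ⊆ A ∪ B) (h1 : ¬ S ⊆ A) (h2 : ¬ S ⊆ B) :
    ¬ Cn G S := by
  rintro ⟨-, hc⟩
  obtain ⟨y, hy, hyA⟩ := Finset.not_subset.1 h1
  obtain ⟨x, hx, hxB⟩ := Finset.not_subset.1 h2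
  have hxA : x ∈ A := by have := hS hx; simp_all
  have hr := hc.preconnected ⟨x, hx⟩ ⟨y, hy⟩
  rw [reachable_iff_reflTransGen] at hr
  have : ∀ z : (S : Set V), Relation.ReflTransGen (G.induce (S : Set V)).Adj ⟨x, hx⟩ z →
      (z : V) ∈ A := by
    intro z hz
    induction hz with
    | refl => exact hxA
    | tail h1 h2 ih =>
      rename_i y z
      have hz := hS z.2
      rcases mem_union.1 hz with hz | hz
      · exact hz
      · exact absurd h2 (hn _ ih _ hz)
  exact hyA (this _ hr)

lemma is_cn {V : Type*} [DecidableEq V] (G : SimpleGraph V) (A B S : Finset V)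
    (hn : ∀ a ∈ A, ∀ b ∈ B, G.Adj a b) (hS : S ⊆ A ∪ B) (h1 : ¬ S ⊆ A) (h2 : ¬ S ⊆ B) :
    Cn G S := by
  obtain ⟨y, hy, hyA⟩ := Finset.not_subset.1 h1
  obtain ⟨x, hx, hxB⟩ := Finset.not_subset.1 h2
  have hxA : x ∈ A := by have := hS hx; simp_all
  have hyB : y ∈ B := by have := hS hy; simp_all
  refine ⟨⟨x, hx⟩, ?_⟩
  have hxy : (G.induce (S : Set V)).Reachable ⟨x, hx⟩ ⟨y, hy⟩ :=
    Adj.reachable (hn x hxA y hyB)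
  rw [connected_iff_exists_forall_reachable]
  refine ⟨⟨x, hx⟩, fun ⟨z, hz⟩ => ?_⟩
  rcases mem_union.1 (hS hz) with h | h
  · exact hxy.trans (Adj.reachable (hn z h y hyB).symm)
  · exact Adj.reachable (hn x hxA z h)

lemma sum_split {V : Type*} [DecidableEq V] (A B : Finset V) (hd : Disjoint A B)
    (g : Finset V → ℤ) :
    ∑ S ∈ (A ∪ B).powerset, g S = ∑ S ∈ A.powerset, g S + ∑ S ∈ B.powerset, g S - g ∅
      + ∑ S ∈ (A ∪ B).powerset with (¬ S ⊆ A ∧ ¬ S ⊆ B), g S := by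
  have h1 := Finset.sum_filter_add_sum_filter_not (A ∪ B).powerset
    (fun S => ¬ S ⊆ A ∧ ¬ S ⊆ B) g
  have h2 : (A ∪ B).powerset.filter (fun S => ¬ (¬ S ⊆ A ∧ ¬ S ⊆ B)) =
      A.powerset ∪ B.powerset := by
    ext S
    simp only [mem_filter, mem_powerset, mem_union]
    constructor
    · rintro ⟨-, h⟩; tauto
    · rintro (h | h)
      · exact ⟨h.trans subset_union_left, by tauto⟩
      · exact ⟨h.trans subset_union_right, by tauto⟩
  have h3 := Finset.sum_union_inter (s₁ := A.powerset) (s₂ := B.powerset) (f := g)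
  have h4 : A.powerset ∩ B.powerset = {∅} := by
    ext S
    simp only [mem_inter, mem_powerset, mem_singleton]
    constructor
    · rintro ⟨h, h'⟩
      exact Finset.subset_empty.1 (by rw [← Finset.disjoint_iff_inter_eq_empty.1 hd]; exact subset_inter h h')
    · rintro rfl; simp
  rw [h2] at h1
  rw [h4, sum_singleton] at h3
  linarith

lemma sum_T {V : Type*} [DecidableEq V] (U : Finset V) (c : ℤ) :
    ∑ S ∈ U.powerset, (2 * (S.card : ℤ) - c) = ((U.card : ℤ) - c) * 2 ^ U.card := by
  induction U using Finset.induction_on generalizing c with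
  | empty => simp
  | insert v U hv ih =>
    rw [sum_powerset_insert hv, ih, card_insert_of_notMem hv]
    have : ∑ t ∈ U.powerset, (2 * ((insert v t).card : ℤ) - c) =
        ∑ t ∈ U.powerset, (2 * (t.card : ℤ) - (c - 2)) := by
      refine sum_congr rfl fun t ht => ?_
      rw [card_insert_of_notMem (fun h => hv (mem_powerset.1 ht h))]
      push_cast; ring
    rw [this, ih]
    push_cast; ring

open Classical in
lemma card_le_cn {V : Type*} (G : SimpleGraph V) (A : Finset V) :
    A.card ≤ (A.powerset.filter (Cn G)).card := by
  refine Finset.card_le_card_of_injOn (fun v => {v}) ?_ ?_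
  · intro v hv
    simp only [coe_filter, mem_powerset, Set.mem_ofPred_eq, singleton_subset_iff]
    exact ⟨hv, cn_singleton G v⟩
  · intro a _ b _ h; simpa using h

open Classical in
lemma shift_bound {V : Type*} (G : SimpleGraph V) (A : Finset V) (b : ℕ) (c : ℤ)
    (hc : c = (A.card : ℤ) + b + 1)
    (hA : ∑ S ∈ A.powerset with Cn G S, (2 * (S.card : ℤ) - (A.card + 1)) ≤ 0) :
    ∑ S ∈ A.powerset with Cn G S, (2 * (S.card : ℤ) - c) ≤ - (A.card * b) := by
  have h1 : ∑ S ∈ A.powerset with Cn G S, (2 * (S.card : ℤ) - c) =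
    ∑ S ∈ A.powerset with Cn G S, (2 * (S.card : ℤ) - (A.card + 1)) -
      (A.powerset.filter (Cn G)).card * b := by
    rw [← nsmul_eq_mul, ← sum_const, ← sum_sub_distrib]
    refine sum_congr rfl fun _ _ => ?_
    rw [hc]; ring
  have h2 : (A.card : ℤ) ≤ (A.powerset.filter (Cn G)).card := by exact_mod_cast card_le_cn G A
  have h3 : (0 : ℤ) ≤ b := by positivity
  nlinarith

open Classical in
lemma key_bound {V : Type*} {G : SimpleGraph V} (h : P4Free G) (U : Finset V) :
    (∑ S ∈ U.powerset with Cn G S, (2 * (S.card : ℤ) - (U.card + 1)) ≤ 0) ∧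
    (2 ≤ U.card → ∑ S ∈ U.powerset with Cn G S, (2 * (S.card : ℤ) - (U.card + 1)) < 0) := by
  induction U using Finset.strongInduction with
  | H U ih =>
  by_cases hU : 2 ≤ U.card
  · suffices hs : ∑ S ∈ U.powerset with Cn G S, (2 * (S.card : ℤ) - (U.card + 1)) < 0 from
      ⟨hs.le, fun _ => hs⟩
    have hsp : ∃ A B : Finset V, A ∪ B = U ∧ Disjoint A B ∧ A.Nonempty ∧ B.Nonempty ∧
        ((∀ a ∈ A, ∀ b ∈ B, ¬ G.Adj a b) ∨ (∀ a ∈ A, ∀ b ∈ B, G.Adj a b)) := by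
      rcases split_exists h U hU with ⟨A, B, h1, h2, h3, h4, h5⟩ | ⟨A, B, h1, h2, h3, h4, h5⟩
      · exact ⟨A, B, h1, h2, h3, h4, Or.inl h5⟩
      · refine ⟨A, B, h1, h2, h3, h4, Or.inr fun a ha b hb => ?_⟩
        have := h5 a ha b hb
        simp only [compl_adj, not_and, not_not] at this
        exact this (fun hab => Finset.disjoint_left.1 h2 ha (hab ▸ hb))
    obtain ⟨A, B, rfl, hd, hA, hB, hor⟩ := hsp
    have hcard := card_union_of_disjoint hd
    have ha : 0 < A.card := hA.card_pos
    have hb : 0 < B.card := hB.card_pos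
    have hAs : A ⊂ A ∪ B := by
      refine ssubset_of_subset_of_ne subset_union_left fun he => ?_
      rw [← he] at hcard; omega
    have hBs : B ⊂ A ∪ B := by
      refine ssubset_of_subset_of_ne subset_union_right fun he => ?_
      rw [← he] at hcard; omega
    set c : ℤ := ((A ∪ B).card : ℤ) + 1 with hc
    have bA := shift_bound G A B.card c (by rw [hc, hcard]; push_cast; ring) (ih A hAs).1
    have bB := shift_bound G B A.card c (by rw [hc, hcard]; push_cast; ring) (ih B hBs).1
    have hs := sum_split A B hd (fun S => if Cn G S then 2 * (S.card : ℤ) - c else 0)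
    have hsg := sum_split A B hd (fun S => 2 * (S.card : ℤ) - c)
    have he : ¬ Cn G ∅ := fun h => by simpa using h.1
    rw [← sum_filter, ← sum_filter, ← sum_filter, if_neg he] at hs
    have hpos : (0 : ℤ) < A.card * B.card := by positivity
    rcases hor with hn | hn
    · have hm : ∑ S ∈ (A ∪ B).powerset with (¬ S ⊆ A ∧ ¬ S ⊆ B),
          (if Cn G S then 2 * (S.card : ℤ) - c else 0) = 0 := by
        refine sum_eq_zero fun S hS => ?_
        simp only [mem_filter, mem_powerset] at hS
        rw [if_neg (not_cn G A B S hn hS.1 hS.2.1 hS.2.2)]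
      nlinarith
    · have hm : ∑ S ∈ (A ∪ B).powerset with (¬ S ⊆ A ∧ ¬ S ⊆ B),
          (if Cn G S then 2 * (S.card : ℤ) - c else 0) =
          ∑ S ∈ (A ∪ B).powerset with (¬ S ⊆ A ∧ ¬ S ⊆ B), (2 * (S.card : ℤ) - c) := by
        refine sum_congr rfl fun S hS => ?_
        simp only [mem_filter, mem_powerset] at hS
        rw [if_pos (is_cn G A B S hn hS.1 hS.2.1 hS.2.2)]
      rw [sum_T, sum_T, sum_T] at hsg
      rw [hm] at hs
      have pa : (A.card : ℤ) + 1 ≤ 2 ^ A.card := by exact_mod_cast Nat.lt_two_pow_self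
      have pb : (B.card : ℤ) + 1 ≤ 2 ^ B.card := by exact_mod_cast Nat.lt_two_pow_self
      have hprod := mul_nonneg (sub_nonneg.2 pa) (sub_nonneg.2 pb)
      have hc' : c = A.card + B.card + 1 := by rw [hc, hcard]; push_cast; ring
      rw [hcard, pow_add] at hsg
      simp only [card_empty] at hsg
      have e : ∀ a b p q M c : ℤ, c = a + b + 1 → 0 ≤ (p - (a + 1)) * (q - (b + 1)) →
          (a + b - c) * (p * q) = (a - c) * p + (b - c) * q - (0 - c) + M → M ≤ a * b := by
        intro a b p q M c h1 h2 h3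
        subst h1
        linarith
      have hM := e _ _ _ _ _ _ hc' hprod (by push_cast at hsg; linarith)
      linarith
  · refine ⟨?_, fun h => absurd h hU⟩
    refine sum_nonpos fun S hS => ?_
    simp only [mem_filter, mem_powerset] at hS
    have := card_le_card hS.1
    have : 2 * S.card ≤ U.card + 1 := by omega
    push_cast [← Nat.cast_le (α := ℤ)] at this
    linarith

theorem stmt_1 {V : Type*} [Fintype V] (G : SimpleGraph V) (n : ℕ) (hn : 1 ≤ n)
    (hcard : Fintype.card V = n) (hcog : IsCograph G) (hconn : G.Connected) :
    globalMean G ≤ ((n : ℝ) + 1) / 2 ∧ (globalMean G = ((n : ℝ) + 1) / 2 ↔ n = 1) := by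
  classical
  have hset : connSets G = (Finset.univ : Finset V).powerset.filter (Cn G) := by
    ext S; simp [connSets, Cn]
  obtain ⟨k1, k2⟩ := key_bound hcog.p4free (Finset.univ : Finset V)
  have hN := card_le_cn G (Finset.univ : Finset V)
  rw [← hset] at k1 k2 hN
  rw [card_univ, hcard] at k1 k2 hN
  have hpos : (0 : ℝ) < (connSets G).card := by exact_mod_cast (by omega)
  have hsum : ((∑ S ∈ connSets G, (2 * (S.card : ℤ) - (n + 1)) : ℤ) : ℝ) =
      2 * (∑ S ∈ connSets G, (S.card : ℝ)) - (n + 1) * (connSets G).card := by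
    push_cast
    rw [sum_sub_distrib, ← mul_sum, sum_const, nsmul_eq_mul]; ring
  have k1' : ((∑ S ∈ connSets G, (2 * (S.card : ℤ) - (n + 1)) : ℤ) : ℝ) ≤ 0 := by
    exact_mod_cast k1
  rw [hsum] at k1'
  have hle : globalMean G ≤ ((n : ℝ) + 1) / 2 := by
    rw [globalMean, div_le_iff₀ hpos]; linarith
  refine ⟨hle, ?_, ?_⟩
  · intro heq
    by_contra hne
    have k2' : ((∑ S ∈ connSets G, (2 * (S.card : ℤ) - (n + 1)) : ℤ) : ℝ) < 0 := by
      exact_mod_cast k2 (by omega)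
    rw [hsum] at k2'
    rw [globalMean, div_eq_iff hpos.ne'] at heq
    linarith
  · rintro rfl
    refine le_antisymm hle ?_
    rw [globalMean, le_div_iff₀ hpos]
    have : ∑ S ∈ connSets G, (1 : ℝ) ≤ ∑ S ∈ connSets G, (S.card : ℝ) := by
      refine sum_le_sum fun S hS => ?_
      rw [hset, mem_filter] at hS
      exact_mod_cast hS.2.1.card_pos
    simp only [sum_const, nsmul_eq_mul, mul_one] at this
    norm_num
    linarith
end

section
/- Let G be a connected cograph of order n ≥ 3. Then M_G ≥ n/2 + 1/(3·2^{n−2}), with equality if and only if G is isomorphic to the n-skillet S_n. -/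
open SimpleGraph Finset

/-- `S` splits into two nonempty mutually nonadjacent parts. -/
def Splt {V : Type*} (G : SimpleGraph V) (S : Finset V) : Prop :=
  ∃ P Q : Finset V, P.Nonempty ∧ Q.Nonempty ∧ Disjoint P Q ∧ (∀ x, x ∈ S ↔ x ∈ P ∨ x ∈ Q) ∧
    ∀ p ∈ P, ∀ q ∈ Q, ¬ G.Adj p q

theorem conn_iff {V : Type*} [Fintype V] (G : SimpleGraph V) (S : Finset V) (hS : S.Nonempty) :
    (G.induce (S : Set V)).Connected ↔ ¬ Splt G S := by
  classical
  constructor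
  · rintro hc ⟨P, Q, ⟨p, hp⟩, ⟨q, hq⟩, hd, hu, ha⟩
    have hpS : p ∈ (S : Set V) := by simp [hu, hp]
    have hqS : q ∈ (S : Set V) := by simp [hu, hq]
    obtain ⟨w⟩ := hc.preconnected ⟨p, hpS⟩ ⟨q, hqS⟩
    have key : ∀ (a b : (S : Set V)), (G.induce (S : Set V)).Walk a b → a.1 ∈ P → b.1 ∈ P := by
      intro a b w
      induction w with
      | nil => exact id
      | cons h w ih =>
        rename_i u v x
        intro hu'
        apply ih
        have hv : v.1 ∈ S := v.2
        rcases (hu _).1 hv with h1 | h1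
        · exact h1
        · exact absurd h (ha _ hu' _ h1)
    have := key _ _ w hp
    exact (Finset.disjoint_left.1 hd this) hq
  · intro hns
    obtain ⟨u, hu⟩ := hS
    rw [SimpleGraph.connected_iff_exists_forall_reachable]
    refine ⟨⟨u, hu⟩, ?_⟩
    by_contra hcon
    push Not at hcon
    obtain ⟨⟨x, hx⟩, hxr⟩ := hcon
    apply hns
    refine ⟨S.filter (fun y => ∃ h : y ∈ (S : Set V), (G.induce (S : Set V)).Reachable ⟨u, hu⟩ ⟨y, h⟩),
      S.filter (fun y => ¬ ∃ h : y ∈ (S : Set V), (G.induce (S : Set V)).Reachable ⟨u, hu⟩ ⟨y, h⟩),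
      ⟨u, ?_⟩, ⟨x, ?_⟩, ?_, ?_, ?_⟩
    · simp only [Finset.mem_filter]; exact ⟨hu, hu, SimpleGraph.Reachable.refl _⟩
    · simp only [Finset.mem_filter]; exact ⟨hx, fun ⟨_, h⟩ => hxr h⟩
    · exact Finset.disjoint_filter_filter_not _ _ _
    · intro y; simp only [Finset.mem_filter]; tauto
    · intro p hp q hq hadj
      simp only [Finset.mem_filter] at hp hq
      obtain ⟨_, hpS, hpr⟩ := hp
      apply hq.2
      refine ⟨hq.1, hpr.trans ?_⟩
      apply SimpleGraph.Adj.reachable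
      exact hadj

def NoP4 {V : Type*} (G : SimpleGraph V) : Prop :=
  ∀ a b c d, G.Adj a b → G.Adj b c → G.Adj c d → ¬ G.Adj a c → ¬ G.Adj b d → ¬ G.Adj a d → False

theorem noP4_of {V : Type*} {G : SimpleGraph V} (h : IsCograph G) : NoP4 G := by
  intro a b c d hab hbc hcd hac hbd had
  have h1 : a ≠ c := by rintro rfl; exact had hcd
  have h2 : b ≠ d := by rintro rfl; exact had hab
  have h3 : a ≠ d := by rintro rfl; exact hbd hab.symm
  apply h.false
  refine ⟨⟨![a, b, c, d], ?_⟩, ?_⟩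
  · intro i j hij
    have := hab.ne; have := hbc.ne; have := hcd.ne
    fin_cases i <;> fin_cases j <;> simp_all
  · intro i j
    have := hab.symm; have := hbc.symm; have := hcd.symm
    have e1 := fun h => hac (SimpleGraph.Adj.symm h)
    have e2 := fun h => hbd (SimpleGraph.Adj.symm h)
    have e3 := fun h => had (SimpleGraph.Adj.symm h)
    change G.Adj (![a, b, c, d] i) (![a, b, c, d] j) ↔ _
    simp only [SimpleGraph.pathGraph_adj]
    fin_cases i <;> fin_cases j <;> simp_all

theorem noP4_compl {V : Type*} {G : SimpleGraph V} (h : NoP4 G) : NoP4 Gᶜ := by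
  intro a b c d hab hbc hcd hac hbd had
  have h1 : a ≠ c := by rintro rfl; exact had hcd
  have h2 : b ≠ d := by rintro rfl; exact had hab
  have h3 : a ≠ d := by rintro rfl; exact hbd hab.symm
  simp only [SimpleGraph.compl_adj, not_and, not_not] at *
  exact h b d a c (hbd h2) (had h3).symm (hac h1) (fun h => hab.2 h.symm) (fun h => hcd.2 h.symm)
    hbc.2

theorem sep_step {V : Type*} [DecidableEq V] {G : SimpleGraph V} (h : NoP4 G) (W : Finset V)
    (v : V) (hv : v ∉ W) (hs : Splt G W) : Splt G (insert v W) ∨ Splt Gᶜ (insert v W) := by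
  classical
  by_contra hcon
  push Not at hcon
  obtain ⟨hn, hnc⟩ := hcon
  have hne : W.Nonempty := by
    obtain ⟨P, Q, ⟨p, hp⟩, _, _, hu, _⟩ := hs
    exact ⟨p, (hu p).2 (Or.inl hp)⟩
  have hy : ∃ y ∈ W, ¬ G.Adj v y := by
    by_contra hall
    push Not at hall
    apply hnc
    refine ⟨{v}, W, by simp, hne, by simpa using hv, by simp, ?_⟩
    intro p hp q hq
    rw [Finset.mem_singleton] at hp
    subst hp
    simp [hall q hq]
  obtain ⟨y, hyW, hvy⟩ := hy
  let fam := W.powerset.filter (fun P => y ∈ P ∧ ∀ p ∈ P, ∀ q ∈ W \ P, ¬ G.Adj p q)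
  have hW : W ∈ fam := by
    simp only [fam, Finset.mem_filter, Finset.mem_powerset, Finset.sdiff_self]
    exact ⟨subset_rfl, hyW, by simp⟩
  obtain ⟨P, hP, hmin⟩ := Finset.exists_min_image fam Finset.card ⟨W, hW⟩
  have hPf := hP
  simp only [fam, Finset.mem_filter, Finset.mem_powerset] at hP
  obtain ⟨hPW, hyP, hPa⟩ := hP
  have hlt : P.card < W.card := by
    obtain ⟨A, B, ⟨a, ha⟩, ⟨b, hb⟩, hd, hu, hab⟩ := hs
    have hAW : A ⊆ W := fun x hx => (hu x).2 (Or.inl hx)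
    have hBW : B ⊆ W := fun x hx => (hu x).2 (Or.inr hx)
    rcases (hu y).1 hyW with h1 | h1
    · have : A ∈ fam := by
        simp only [fam, Finset.mem_filter, Finset.mem_powerset]
        refine ⟨hAW, h1, fun p hp q hq => hab p hp q ?_⟩
        have := (hu q)
        simp only [Finset.mem_sdiff] at hq
        tauto
      refine (hmin A this).trans_lt (Finset.card_lt_card ⟨hAW, fun hh => ?_⟩)
      exact Finset.disjoint_left.1 hd (hh (hBW hb)) hb
    · have : B ∈ fam := by
        simp only [fam, Finset.mem_filter, Finset.mem_powerset]
        refine ⟨hBW, h1, fun p hp q hq hh => hab q ?_ p hp hh.symm⟩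
        have := (hu q)
        simp only [Finset.mem_sdiff] at hq
        tauto
      refine (hmin B this).trans_lt (Finset.card_lt_card ⟨hBW, fun hh => ?_⟩)
      exact Finset.disjoint_left.1 hd ha (hh (hAW ha))
  have hQne : (W \ P).Nonempty := by
    rw [Finset.nonempty_iff_ne_empty]
    intro h0
    rw [Finset.sdiff_eq_empty_iff_subset] at h0
    exact absurd (Finset.card_le_card h0) (by omega)
  have hvP : v ∉ P := fun hh => hv (hPW hh)
  have hPN : ∃ x ∈ P, G.Adj v x := by
    by_contra hall
    push Not at hall
    apply hn
    refine ⟨P, insert v (W \ P), ⟨y, hyP⟩, by simp, ?_, ?_, ?_⟩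
    · rw [Finset.disjoint_insert_right]
      exact ⟨hvP, Finset.disjoint_sdiff⟩
    · intro x
      have := @hPW x
      simp only [Finset.mem_insert, Finset.mem_sdiff]
      tauto
    · intro p hp q hq hh
      rw [Finset.mem_insert] at hq
      rcases hq with rfl | hq
      · exact hall p hp hh.symm
      · exact hPa p hp q hq hh
  have hQN : ∃ q ∈ W \ P, G.Adj v q := by
    by_contra hall
    push Not at hall
    apply hn
    refine ⟨insert v P, W \ P, by simp, hQne, ?_, ?_, ?_⟩
    · rw [Finset.disjoint_insert_left]
      exact ⟨by simp [hv], Finset.disjoint_sdiff⟩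
    · intro x
      have := @hPW x
      simp only [Finset.mem_insert, Finset.mem_sdiff]
      tauto
    · intro p hp q hq hh
      rw [Finset.mem_insert] at hp
      rcases hp with rfl | hp
      · exact hall q hq hh
      · exact hPa p hp q hq hh
  obtain ⟨q, hq, hvq⟩ := hQN
  obtain ⟨x0, hx0, hvx0⟩ := hPN
  have hE : ∃ x ∈ P, ∃ z ∈ P, G.Adj v x ∧ ¬ G.Adj v z ∧ G.Adj z x := by
    by_contra hall
    push Not at hall
    have hf : P.filter (fun z => ¬ G.Adj v z) ∈ fam := by
      simp only [fam, Finset.mem_filter, Finset.mem_powerset]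
      refine ⟨(Finset.filter_subset _ _).trans hPW, ⟨hyP, hvy⟩, ?_⟩
      intro z hz t ht hh
      simp only [Finset.mem_sdiff, Finset.mem_filter, not_and, not_not] at ht
      by_cases htP : t ∈ P
      · exact hall t htP z hz.1 (ht.2 htP) hz.2 hh
      · exact hPa z hz.1 t (by simp [ht.1, htP]) hh
    have h1 := hmin _ hf
    have h2 : (P.filter (fun z => ¬ G.Adj v z)).card < P.card := by
      apply Finset.card_lt_card
      refine ⟨Finset.filter_subset _ _, fun hh => ?_⟩
      have := hh hx0
      rw [Finset.mem_filter] at this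
      exact this.2 hvx0
    omega
  obtain ⟨x, hx, z, hz, hvx, hvz, hzx⟩ := hE
  exact h z x v q hzx hvx.symm hvq (fun hh => hvz hh.symm) (hPa x hx q hq) (hPa z hz q hq)

theorem sep_or {V : Type*} {G : SimpleGraph V} (h : NoP4 G) (W : Finset V) (hW : 2 ≤ W.card) :
    Splt G W ∨ Splt Gᶜ W := by
  classical
  induction W using Finset.induction_on with
  | empty => simp at hW
  | insert v W hv ih =>
    by_cases h2 : 2 ≤ W.card
    · rcases ih h2 with h1 | h1
      · exact sep_step h W v hv h1
      · have := sep_step (noP4_compl h) W v hv h1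
        rw [compl_compl] at this
        exact this.symm
    · rw [Finset.card_insert_of_notMem hv] at hW
      have h1 : W.card = 1 := by omega
      obtain ⟨u, rfl⟩ := Finset.card_eq_one.1 h1
      have hvu : v ≠ u := by simpa using hv
      by_cases ha : G.Adj v u
      · right
        exact ⟨{v}, {u}, by simp, by simp, by simpa using hvu, by simp, by simp [ha]⟩
      · left
        exact ⟨{v}, {u}, by simp, by simp, by simpa using hvu, by simp, by simp [ha]⟩

open Classical in
noncomputable def DS {V : Type*} (G : SimpleGraph V) (W : Finset V) : Finset (Finset V) :=
  W.powerset.filter (Splt G)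

theorem mem_DS {V : Type*} {G : SimpleGraph V} {W S : Finset V} :
    S ∈ DS G W ↔ S ⊆ W ∧ Splt G S := by simp [DS]

theorem sep_two {V : Type*} {G : SimpleGraph V} {S : Finset V} (h : Splt G S) : 2 ≤ S.card := by
  classical
  obtain ⟨P, Q, hP, hQ, hd, hu, _⟩ := h
  have : S = P ∪ Q := by ext; simp [hu]
  rw [this, Finset.card_union_of_disjoint hd]
  have := hP.card_pos
  have := hQ.card_pos
  omega

/-- The union case. -/
theorem sum_union {V : Type*} [DecidableEq V] {G : SimpleGraph V} {P Q : Finset V}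
    (hd : Disjoint P Q) (ha : ∀ p ∈ P, ∀ q ∈ Q, ¬ G.Adj p q) (f : Finset V → ℤ) :
    ∑ S ∈ DS G (P ∪ Q), f S = ∑ S ∈ DS G P, f S + ∑ S ∈ DS G Q, f S +
      (∑ S ∈ (P ∪ Q).powerset, f S - ∑ S ∈ P.powerset, f S - ∑ S ∈ Q.powerset, f S + f ∅) := by
  classical
  have hi : P.powerset ∩ Q.powerset = {∅} := by
    ext S
    simp only [Finset.mem_inter, Finset.mem_powerset, Finset.mem_singleton]
    constructor
    · rintro ⟨h1, h2⟩
      have := hd h1 h2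
      simpa using this
    · rintro rfl; simp
  have h1 := Finset.sum_union_inter (s₁ := P.powerset) (s₂ := Q.powerset) (f := f)
  rw [hi, Finset.sum_singleton] at h1
  have hsub : P.powerset ∪ Q.powerset ⊆ (P ∪ Q).powerset := by
    intro S
    simp only [Finset.mem_union, Finset.mem_powerset]
    rintro (h | h)
    · exact h.trans Finset.subset_union_left
    · exact h.trans Finset.subset_union_right
  have h2 := Finset.sum_sdiff hsub (f := f)
  have hD : DS G (P ∪ Q) =
      (DS G P ∪ DS G Q) ∪ ((P ∪ Q).powerset \ (P.powerset ∪ Q.powerset)) := by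
    ext S
    simp only [mem_DS, Finset.mem_union, Finset.mem_sdiff, Finset.mem_powerset]
    constructor
    · tauto
    · rintro ((⟨h, h'⟩ | ⟨h, h'⟩) | ⟨h, h'⟩)
      · exact ⟨h.trans Finset.subset_union_left, h'⟩
      · exact ⟨h.trans Finset.subset_union_right, h'⟩
      · refine ⟨h, S ∩ P, S ∩ Q, ?_, ?_, ?_, ?_, ?_⟩
        · rw [Finset.nonempty_iff_ne_empty]
          intro h0
          apply h'
          right
          intro x hx
          rcases Finset.mem_union.1 (h hx) with h1 | h1
          · have : x ∈ S ∩ P := by simp [hx, h1]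
            simp [h0] at this
          · exact h1
        · rw [Finset.nonempty_iff_ne_empty]
          intro h0
          apply h'
          left
          intro x hx
          rcases Finset.mem_union.1 (h hx) with h1 | h1
          · exact h1
          · have : x ∈ S ∩ Q := by simp [hx, h1]
            simp [h0] at this
        · exact hd.mono Finset.inter_subset_right Finset.inter_subset_right
        · intro x
          have := @h x
          simp only [Finset.mem_union, Finset.mem_inter] at *
          tauto
        · intro p hp q hq
          simp only [Finset.mem_inter] at hp hq
          exact ha p hp.2 q hq.2
  have hdd : Disjoint (DS G P) (DS G Q) := by
    rw [Finset.disjoint_left]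
    intro S h1 h2
    rw [mem_DS] at h1 h2
    have h3 := sep_two h1.2
    have h4 : S = ∅ := by simpa using hd h1.1 h2.1
    simp [h4] at h3
  rw [hD, Finset.sum_union, Finset.sum_union hdd]
  · linarith
  · rw [Finset.disjoint_left]
    intro S hS
    simp only [mem_DS, Finset.mem_union, Finset.mem_sdiff, Finset.mem_powerset] at *
    tauto

/-- The join case. -/
theorem sum_join {V : Type*} [DecidableEq V] {G : SimpleGraph V} {P Q : Finset V}
    (hd : Disjoint P Q) (ha : ∀ p ∈ P, ∀ q ∈ Q, G.Adj p q) (f : Finset V → ℤ) :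
    ∑ S ∈ DS G (P ∪ Q), f S = ∑ S ∈ DS G P, f S + ∑ S ∈ DS G Q, f S := by
  classical
  have hD : DS G (P ∪ Q) = DS G P ∪ DS G Q := by
    ext S
    simp only [mem_DS, Finset.mem_union]
    constructor
    · rintro ⟨h, h'⟩
      by_cases hP : S ⊆ P
      · exact Or.inl ⟨hP, h'⟩
      by_cases hQ : S ⊆ Q
      · exact Or.inr ⟨hQ, h'⟩
      exfalso
      rw [Finset.not_subset] at hP hQ
      obtain ⟨t, ht, htP⟩ := hP
      obtain ⟨s, hs, hsQ⟩ := hQ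
      have htQ : t ∈ Q := by have := h ht; simp at this; tauto
      have hsP : s ∈ P := by have := h hs; simp at this; tauto
      obtain ⟨X, Y, ⟨x, hx⟩, ⟨y, hy⟩, hdXY, hu, hXY⟩ := h'
      have hst := ha s hsP t htQ
      have hxS := (hu x).2 (Or.inl hx)
      have hyS := (hu y).2 (Or.inr hy)
      rcases (hu s).1 hs with hs' | hs'
      · have ht' : t ∈ X := ((hu t).1 ht).resolve_right (fun hh => hXY s hs' t hh hst)
        rcases Finset.mem_union.1 (h hyS) with h1 | h1
        · exact hXY t ht' y hy (ha y h1 t htQ).symm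
        · exact hXY s hs' y hy (ha s hsP y h1)
      · have ht' : t ∈ Y := ((hu t).1 ht).resolve_left (fun hh => hXY t hh s hs' hst.symm)
        rcases Finset.mem_union.1 (h hxS) with h1 | h1
        · exact hXY x hx t ht' (ha x h1 t htQ)
        · exact hXY x hx s hs' (ha s hsP x h1).symm
    · rintro (⟨h, h'⟩ | ⟨h, h'⟩)
      · exact ⟨h.trans Finset.subset_union_left, h'⟩
      · exact ⟨h.trans Finset.subset_union_right, h'⟩
  have hdd : Disjoint (DS G P) (DS G Q) := by
    rw [Finset.disjoint_left]
    intro S h1 h2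
    rw [mem_DS] at h1 h2
    have h3 := sep_two h1.2
    have h4 : S = ∅ := by simpa using hd h1.1 h2.1
    simp [h4] at h3
  rw [hD, Finset.sum_union hdd]

noncomputable def dd {V : Type*} (G : SimpleGraph V) (W : Finset V) : ℤ := ∑ _S ∈ DS G W, 1
noncomputable def ee {V : Type*} (G : SimpleGraph V) (W : Finset V) : ℤ :=
  ∑ S ∈ DS G W, 2 * (S.card : ℤ)

theorem sum_pow_one {V : Type*} (W : Finset V) : ∑ _S ∈ W.powerset, (1 : ℤ) = 2 ^ W.card := by
  simp

theorem sum_pow_card {V : Type*} (W : Finset V) :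
    ∑ S ∈ W.powerset, 2 * (S.card : ℤ) = W.card * 2 ^ W.card := by
  classical
  induction W using Finset.induction_on with
  | empty => simp
  | insert v W hv ih =>
    rw [Finset.sum_powerset_insert hv, Finset.card_insert_of_notMem hv, ih]
    have : ∑ S ∈ W.powerset, 2 * ((insert v S).card : ℤ)
        = ∑ S ∈ W.powerset, (2 * (S.card : ℤ) + 2 * 1) := by
      apply Finset.sum_congr rfl
      intro S hS
      rw [Finset.mem_powerset] at hS
      rw [Finset.card_insert_of_notMem (fun h => hv (hS h))]
      push_cast; ring
    rw [this, Finset.sum_add_distrib, ← Finset.mul_sum _ _ (2 : ℤ), ← Finset.mul_sum _ _ (2 : ℤ),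
      sum_pow_one, Finset.mul_sum, ih]
    push_cast; ring

theorem dd_nonneg {V : Type*} (G : SimpleGraph V) (W : Finset V) : 0 ≤ dd G W := by
  unfold dd; positivity

theorem dd_union {V : Type*} [DecidableEq V] {G : SimpleGraph V} {P Q : Finset V}
    (hd : Disjoint P Q) (ha : ∀ p ∈ P, ∀ q ∈ Q, ¬ G.Adj p q) :
    dd G (P ∪ Q) = dd G P + dd G Q + (2 ^ P.card * 2 ^ Q.card - 2 ^ P.card - 2 ^ Q.card + 1) := by
  unfold dd
  rw [sum_union hd ha, sum_pow_one, sum_pow_one, sum_pow_one, Finset.card_union_of_disjoint hd,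
    pow_add]

theorem ee_union {V : Type*} [DecidableEq V] {G : SimpleGraph V} {P Q : Finset V}
    (hd : Disjoint P Q) (ha : ∀ p ∈ P, ∀ q ∈ Q, ¬ G.Adj p q) :
    ee G (P ∪ Q) = ee G P + ee G Q + ((P.card + Q.card) * (2 ^ P.card * 2 ^ Q.card)
      - P.card * 2 ^ P.card - Q.card * 2 ^ Q.card) := by
  unfold ee
  rw [sum_union hd ha, sum_pow_card, sum_pow_card, sum_pow_card, Finset.card_union_of_disjoint hd,
    pow_add]
  simp

theorem small {V : Type*} (G : SimpleGraph V) (W : Finset V) (h : W.card ≤ 1) :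
    dd G W = 0 ∧ ee G W = 0 := by
  have : DS G W = ∅ := by
    rw [Finset.eq_empty_iff_forall_notMem]
    intro S hS
    rw [mem_DS] at hS
    have := sep_two hS.2
    have := Finset.card_le_card hS.1
    omega
  simp [dd, ee, this]

theorem two_pow_ge (p : ℕ) (hp : 1 ≤ p) : (2 * p : ℤ) ≤ 2 ^ p := by
  induction p, hp using Nat.le_induction with
  | base => norm_num
  | succ k hk ih => rw [pow_succ]; push_cast; have : (1 : ℤ) ≤ k := by exact_mod_cast hk
                    linarith

theorem sep_data {V : Type*} [DecidableEq V] {G : SimpleGraph V} {W : Finset V} (h : Splt G W) :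
    ∃ P Q : Finset V, 1 ≤ P.card ∧ 1 ≤ Q.card ∧ Disjoint P Q ∧ W = P ∪ Q ∧
      ∀ p ∈ P, ∀ q ∈ Q, ¬ G.Adj p q := by
  obtain ⟨P, Q, hP, hQ, hd, hu, ha⟩ := h
  exact ⟨P, Q, hP.card_pos, hQ.card_pos, hd, by ext; simp [hu], ha⟩

theorem sepc_data {V : Type*} [DecidableEq V] {G : SimpleGraph V} {W : Finset V} (h : Splt Gᶜ W) :
    ∃ P Q : Finset V, 1 ≤ P.card ∧ 1 ≤ Q.card ∧ Disjoint P Q ∧ W = P ∪ Q ∧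
      ∀ p ∈ P, ∀ q ∈ Q, G.Adj p q := by
  obtain ⟨P, Q, hP, hQ, hd, hu, ha⟩ := h
  refine ⟨P, Q, hP.card_pos, hQ.card_pos, hd, by ext; simp [hu], fun p hp q hq => ?_⟩
  have := ha p hp q hq
  have hne : p ≠ q := by rintro rfl; exact Finset.disjoint_left.1 hd hp hq
  simpa [hne] using this

theorem dd_join {V : Type*} [DecidableEq V] {G : SimpleGraph V} {P Q : Finset V}
    (hd : Disjoint P Q) (ha : ∀ p ∈ P, ∀ q ∈ Q, G.Adj p q) :
    dd G (P ∪ Q) = dd G P + dd G Q := sum_join hd ha _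

theorem ee_join {V : Type*} [DecidableEq V] {G : SimpleGraph V} {P Q : Finset V}
    (hd : Disjoint P Q) (ha : ∀ p ∈ P, ∀ q ∈ Q, G.Adj p q) :
    ee G (P ∪ Q) = ee G P + ee G Q := sum_join hd ha _

theorem C2 {V : Type*} [DecidableEq V] {G : SimpleGraph V} (h : NoP4 G) (m : ℕ) :
    ∀ W : Finset V, W.card = m → 0 ≤ (W.card + 2) * dd G W - ee G W := by
  induction m using Nat.strong_induction_on with
  | _ m ih =>
  intro W hm
  by_cases h1 : W.card ≤ 1
  · obtain ⟨h2, h3⟩ := small G W h1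
    rw [h2, h3]; simp
  rcases sep_or h W (by omega) with hs | hs
  · obtain ⟨P, Q, hP, hQ, hd, rfl, ha⟩ := sep_data hs
    have hc := Finset.card_union_of_disjoint hd
    have iP := ih P.card (by omega) P rfl
    have iQ := ih Q.card (by omega) Q rfl
    rw [dd_union hd ha, ee_union hd ha, hc]
    have dP := dd_nonneg G P
    have dQ := dd_nonneg G Q
    have tP := two_pow_ge _ hP
    have tQ := two_pow_ge _ hQ
    push_cast
    have hP' : (1 : ℤ) ≤ P.card := by exact_mod_cast hP
    have hQ' : (1 : ℤ) ≤ Q.card := by exact_mod_cast hQ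
    generalize (P.card : ℤ) = p at *
    generalize (Q.card : ℤ) = q at *
    generalize (2 : ℤ) ^ P.card = x at *
    generalize (2 : ℤ) ^ Q.card = y at *
    have m1 := mul_nonneg (by linarith : 0 ≤ q) dP
    have m2 := mul_nonneg (by linarith : 0 ≤ p) dQ
    have m3 := mul_nonneg (by linarith : 0 ≤ x - 1 - p) (by linarith : 0 ≤ y - 1)
    have m4 := mul_nonneg (by linarith : 0 ≤ x - 1) (by linarith : 0 ≤ y - 1 - q)
    linarith
  · obtain ⟨P, Q, hP, hQ, hd, rfl, ha⟩ := sepc_data hs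
    have hc := Finset.card_union_of_disjoint hd
    have iP := ih P.card (by omega) P rfl
    have iQ := ih Q.card (by omega) Q rfl
    rw [dd_join hd ha, ee_join hd ha, hc]
    have m1 := mul_nonneg (by positivity : (0 : ℤ) ≤ Q.card) (dd_nonneg G P)
    have m2 := mul_nonneg (by positivity : (0 : ℤ) ≤ P.card) (dd_nonneg G Q)
    push_cast
    linarith

theorem C1_join {V : Type*} [DecidableEq V] {G : SimpleGraph V} (h : NoP4 G) (W : Finset V)
    (hs : ¬ Splt G W) : 0 ≤ (W.card + 1) * dd G W - ee G W := by
  by_cases h1 : W.card ≤ 1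
  · obtain ⟨h2, h3⟩ := small G W h1
    rw [h2, h3]; simp
  have hs := (sep_or h W (by omega)).resolve_left hs
  obtain ⟨P, Q, hP, hQ, hd, rfl, ha⟩ := sepc_data hs
  have hc := Finset.card_union_of_disjoint hd
  have iP := C2 h _ P rfl
  have iQ := C2 h _ Q rfl
  rw [dd_join hd ha, ee_join hd ha, hc]
  have hP' : (1 : ℤ) ≤ P.card := by exact_mod_cast hP
  have hQ' : (1 : ℤ) ≤ Q.card := by exact_mod_cast hQ
  have m1 := mul_nonneg (by linarith : (0 : ℤ) ≤ Q.card - 1) (dd_nonneg G P)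
  have m2 := mul_nonneg (by linarith : (0 : ℤ) ≤ P.card - 1) (dd_nonneg G Q)
  push_cast
  linarith

theorem C1 {V : Type*} [DecidableEq V] {G : SimpleGraph V} (h : NoP4 G) (W : Finset V)
    (hW : 1 ≤ W.card) : 1 - W.card ≤ (W.card + 1) * dd G W - ee G W := by
  have hW' : (1 : ℤ) ≤ W.card := by exact_mod_cast hW
  by_cases hs : Splt G W
  · obtain ⟨P, Q, hP, hQ, hd, rfl, ha⟩ := sep_data hs
    have hc := Finset.card_union_of_disjoint hd
    have iP := C2 h _ P rfl
    have iQ := C2 h _ Q rfl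
    rw [dd_union hd ha, ee_union hd ha, hc]
    have dP := dd_nonneg G P
    have dQ := dd_nonneg G Q
    have tP := two_pow_ge _ hP
    have tQ := two_pow_ge _ hQ
    push_cast
    have hP' : (1 : ℤ) ≤ P.card := by exact_mod_cast hP
    have hQ' : (1 : ℤ) ≤ Q.card := by exact_mod_cast hQ
    generalize (P.card : ℤ) = p at *
    generalize (Q.card : ℤ) = q at *
    generalize (2 : ℤ) ^ P.card = x at *
    generalize (2 : ℤ) ^ Q.card = y at *
    have m1 := mul_nonneg (by linarith : 0 ≤ q - 1) dP
    have m2 := mul_nonneg (by linarith : 0 ≤ p - 1) dQ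
    have m3 := mul_le_mul (by linarith : p - 1 ≤ x - 1 - p) (by linarith : q - 1 ≤ y - 1 - q)
      (by linarith) (by linarith)
    linarith
  · have := C1_join h W hs
    linarith

/-- Intrinsic description of the skillet. -/
def IsSk {V : Type*} (G : SimpleGraph V) (c w : V) : Prop :=
  c ≠ w ∧ ∀ x y, G.Adj x y ↔ x ≠ y ∧ (x = c ∨ y = c ∨ (x ≠ w ∧ y ≠ w))

theorem iso_iff {V : Type*} [Fintype V] (G : SimpleGraph V) (n : ℕ) (hn : 3 ≤ n)
    (hcard : Fintype.card V = n) : Nonempty (G ≃g skillet n) ↔ ∃ c w, IsSk G c w := by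
  classical
  obtain ⟨m, rfl⟩ : ∃ m, n = m + 3 := ⟨n - 3, by omega⟩
  have hsk : ∀ i j : Fin (m + 3), (skillet (m + 3)).Adj i j ↔
      i ≠ j ∧ (i = 0 ∨ j = 0 ∨ (i ≠ 1 ∧ j ≠ 1)) := by
    intro i j
    simp only [skillet, SimpleGraph.fromRel_adj, Fin.ext_iff, ne_eq, Fin.val_zero, Fin.val_one]
    omega
  constructor
  · rintro ⟨e⟩
    refine ⟨e.symm 0, e.symm 1, ?_, ?_⟩
    · intro h
      have := e.symm.injective h
      simp at this
    · intro x y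
      rw [← e.map_adj_iff, hsk]
      have hx : ∀ (z : V) (i : Fin (m+3)), e z = i ↔ z = e.symm i := by
        intro z i
        exact e.toEquiv.eq_symm_apply.symm
      simp only [ne_eq, hx, e.injective.eq_iff]
      simp
  · rintro ⟨c, w, hcw, hadj⟩
    let e0 : V ≃ Fin (m + 3) := Fintype.equivFinOfCardEq hcard
    let e1 := e0.trans (Equiv.swap (e0 c) 0)
    let e2 := e1.trans (Equiv.swap (e1 w) 1)
    have h1 : e1 c = 0 := by simp [e1]
    have hw : e1 w ≠ 0 := fun h => hcw (e1.injective (h1.trans h.symm))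
    have h2 : e2 c = 0 := by
      simp only [e2, Equiv.trans_apply, h1]
      exact Equiv.swap_apply_of_ne_of_ne hw.symm (by simp)
    have h3 : e2 w = 1 := by simp [e2]
    refine ⟨⟨e2, ?_⟩⟩
    intro x y
    rw [hsk, hadj, ← h2, ← h3]
    simp only [ne_eq, e2.injective.eq_iff]

theorem clique_DS {V : Type*} {G : SimpleGraph V} {P : Finset V}
    (h : ∀ x ∈ P, ∀ y ∈ P, x ≠ y → G.Adj x y) : dd G P = 0 ∧ ee G P = 0 := by
  have : DS G P = ∅ := by
    rw [Finset.eq_empty_iff_forall_notMem]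
    intro S hS
    rw [mem_DS] at hS
    obtain ⟨hSP, A, B, ⟨a, ha⟩, ⟨b, hb⟩, hd, hu, hab⟩ := hS
    refine hab a ha b hb (h a (hSP ((hu a).2 (Or.inl ha))) b (hSP ((hu b).2 (Or.inr hb))) ?_)
    rintro rfl
    exact Finset.disjoint_left.1 hd ha hb
  simp [dd, ee, this]

theorem clique_of {V : Type*} {G : SimpleGraph V} {P : Finset V} (h : dd G P = 0) :
    ∀ x ∈ P, ∀ y ∈ P, x ≠ y → G.Adj x y := by
  classical
  intro x hx y hy hxy
  by_contra hadj
  have h0 : DS G P = ∅ := by simpa [dd] using h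
  have : {x, y} ∈ DS G P := by
    rw [mem_DS]
    refine ⟨by simp [Finset.insert_subset_iff, hx, hy], {x}, {y}, by simp, by simp,
      by simpa using hxy, by simp, by simp [hadj]⟩
  simp [h0] at this

theorem sk_calc {V : Type*} [Fintype V] (G : SimpleGraph V) (m : ℕ)
    (hcard : Fintype.card V = m + 2) {c w : V} (hsk : IsSk G c w) :
    dd G univ = 2 ^ m - 1 ∧ (m + 2 : ℤ) + (m + 2) * dd G univ - ee G univ = 2 := by
  classical
  obtain ⟨hcw, hadj⟩ := hsk
  let R : Finset V := univ.filter (fun x => x ≠ c ∧ x ≠ w)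
  have hd2 : Disjoint {w} R := by simp [R]
  have hd1 : Disjoint {c} ({w} ∪ R) := by simp [R, hcw]
  have hu : (univ : Finset V) = {c} ∪ ({w} ∪ R) := by
    ext x; simp [R]; tauto
  have ha2 : ∀ p ∈ ({w} : Finset V), ∀ q ∈ R, ¬ G.Adj p q := by
    intro p hp q hq
    simp [R] at hp hq
    subst hp
    rw [hadj]
    tauto
  have ha1 : ∀ p ∈ ({c} : Finset V), ∀ q ∈ {w} ∪ R, G.Adj p q := by
    intro p hp q hq
    have h1 : p = c := by simpa using hp
    rw [hadj]
    refine ⟨?_, Or.inl h1⟩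
    rintro rfl
    exact Finset.disjoint_left.1 hd1 hp hq
  have hR : R.card = m := by
    have := congrArg Finset.card hu
    rw [Finset.card_union_of_disjoint hd1, Finset.card_union_of_disjoint hd2, Finset.card_univ,
      hcard] at this
    simp at this
    omega
  obtain ⟨a1, a2⟩ := clique_DS (G := G) (P := R) (by
    intro x hx y hy hxy
    simp [R] at hx hy
    rw [hadj]; tauto)
  obtain ⟨b1, b2⟩ := small G {c} (by simp)
  obtain ⟨c1, c2⟩ := small G {w} (by simp)
  rw [hu, dd_join hd1 ha1, ee_join hd1 ha1, dd_union hd2 ha2, ee_union hd2 ha2, a1, a2, b1, b2,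
    c1, c2, hR]
  simp
  constructor <;> ring

/-- Structure extraction with one-vertex side. -/
theorem extract {V : Type*} [Fintype V] [DecidableEq V] {G : SimpleGraph V} (h : NoP4 G) (m : ℕ)
    (hm : 1 ≤ m) (hcard : Fintype.card V = m + 2) {A B : Finset V} (hB : B.card = 1)
    (hd : Disjoint A B) (hu : univ = A ∪ B) (ha : ∀ p ∈ A, ∀ q ∈ B, G.Adj p q)
    (hT : (m + 2 : ℤ) + (m + 2) * dd G univ - ee G univ = 2) :
    2 ^ m - 1 ≤ dd G univ ∧ (dd G univ = 2 ^ m - 1 → ∃ c w, IsSk G c w) := by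
  obtain ⟨c, rfl⟩ := Finset.card_eq_one.1 hB
  have hA : A.card = m + 1 := by
    have := congrArg Finset.card hu
    rw [Finset.card_union_of_disjoint hd, Finset.card_univ, hcard] at this
    simp at this
    omega
  obtain ⟨b1, b2⟩ := small G {c} (by simp)
  rw [hu, dd_join hd ha, ee_join hd ha, b1, b2] at hT
  rw [hu, dd_join hd ha, b1]
  simp only [add_zero] at hT ⊢
  have hsep : Splt G A := by
    by_contra hns
    have := C1_join h A hns
    rw [hA] at this
    push_cast at this
    have : (1 : ℤ) ≤ m := by exact_mod_cast hm
    linarith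
  have main : ∀ P Q : Finset V, 1 ≤ P.card → 1 ≤ Q.card → Disjoint P Q → A = P ∪ Q →
      (∀ p ∈ P, ∀ q ∈ Q, ¬ G.Adj p q) → Q.card = 1 → dd G P = 0 → ∃ c w, IsSk G c w := by
    intro P Q hP hQ hPQ hAPQ hna hQ1 hdP
    obtain ⟨w, rfl⟩ := Finset.card_eq_one.1 hQ1
    have hcl := clique_of hdP
    have hcA : c ∉ A := by simpa using hd
    have hwA : w ∈ A := by simp [hAPQ]
    have hwP : w ∉ P := by simpa using hPQ
    refine ⟨c, w, fun hh => hcA (hh ▸ hwA), ?_⟩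
    have hcadj : ∀ x, x ≠ c → G.Adj x c := by
      intro x hx
      have : x ∈ A ∪ {c} := hu ▸ Finset.mem_univ x
      simp only [Finset.mem_union, Finset.mem_singleton, hx, or_false] at this
      exact ha x this c (by simp)
    have hmem : ∀ x, x ≠ c → x ≠ w → x ∈ P := by
      intro x hx hxw
      have : x ∈ A ∪ {c} := hu ▸ Finset.mem_univ x
      simpa [hAPQ, hx, hxw] using this
    intro x y
    by_cases hxy : x = y
    · subst hxy; simp
    by_cases hx : x = c
    · subst hx; simp [hxy, (hcadj y (Ne.symm hxy)).symm]
    by_cases hy : y = c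
    · subst hy; simp [hxy, hcadj x hxy]
    by_cases hxw : x = w
    · subst hxw
      have := hna y (hmem y hy (Ne.symm hxy)) x (by simp)
      have h2 : ¬ G.Adj x y := fun hh => this hh.symm
      simp [hx, hy, h2]
    by_cases hyw : y = w
    · subst hyw
      have := hna x (hmem x hx hxy) y (by simp)
      simp [hx, hy, this]
    simp [hxy, hxw, hyw, hcl x (hmem x hx hxw) y (hmem y hy hyw) hxy]
  obtain ⟨P, Q, hP, hQ, hPQ, hAPQ, hna⟩ := sep_data hsep
  have hc := Finset.card_union_of_disjoint hPQ
  rw [← hAPQ, hA] at hc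
  have hdu := dd_union (G := G) hPQ hna
  rw [← hAPQ] at hdu
  have dP := dd_nonneg G P
  have dQ := dd_nonneg G Q
  have hpow : (2 : ℤ) ^ P.card * 2 ^ Q.card = 2 * 2 ^ m := by
    rw [← pow_add, ← hc, pow_succ]; ring
  have two_le : ∀ k : ℕ, 1 ≤ k → (2 : ℤ) ≤ 2 ^ k ∧ (2 ≤ k → (4 : ℤ) ≤ 2 ^ k) := by
    intro k hk
    have := two_pow_ge k hk
    have : (1 : ℤ) ≤ k := by exact_mod_cast hk
    refine ⟨by linarith, fun h2 => ?_⟩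
    have : (2 : ℤ) ≤ k := by exact_mod_cast h2
    linarith
  obtain ⟨tP, tP'⟩ := two_le _ hP
  obtain ⟨tQ, tQ'⟩ := two_le _ hQ
  have m1 := mul_nonneg (by linarith : (0 : ℤ) ≤ 2 ^ P.card - 2) (by linarith : (0 : ℤ) ≤ 2 ^ Q.card - 2)
  constructor
  · linarith
  · intro heq
    have hdP : dd G P = 0 := by linarith
    have hdQ : dd G Q = 0 := by linarith
    by_cases hq1 : Q.card = 1
    · exact main P Q hP hQ hPQ hAPQ hna hq1 hdP
    by_cases hp1 : P.card = 1
    · exact main Q P hQ hP hPQ.symm (by rw [hAPQ, Finset.union_comm])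
        (fun p hp q hq hh => hna q hq p hp hh.symm) hp1 hdQ
    exfalso
    have t1 := tP' (by omega)
    have t2 := tQ' (by omega)
    have := mul_le_mul (by linarith : (2 : ℤ) ≤ 2 ^ P.card - 2)
      (by linarith : (2 : ℤ) ≤ 2 ^ Q.card - 2) (by norm_num) (by linarith)
    linarith

theorem core {V : Type*} [Fintype V] {G : SimpleGraph V} (h : NoP4 G) (m : ℕ)
    (hm : 1 ≤ m) (hcard : Fintype.card V = m + 2) (hns : ¬ Splt G univ) :
    2 ≤ (m + 2 : ℤ) + (m + 2) * dd G univ - ee G univ ∧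
    ((m + 2 : ℤ) + (m + 2) * dd G univ - ee G univ = 2 →
      2 ^ m - 1 ≤ dd G univ ∧ (dd G univ = 2 ^ m - 1 → ∃ c w, IsSk G c w)) := by
  classical
  have hs := (sep_or h univ (by rw [Finset.card_univ]; omega)).resolve_left hns
  obtain ⟨A, B, hA, hB, hd, hu, ha⟩ := sepc_data hs
  have hc : A.card + B.card = m + 2 := by
    rw [← Finset.card_union_of_disjoint hd, ← hu, Finset.card_univ, hcard]
  have iA := C1 h A hA
  have iB := C1 h B hB
  have hA' : (1 : ℤ) ≤ A.card := by exact_mod_cast hA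
  have hB' : (1 : ℤ) ≤ B.card := by exact_mod_cast hB
  have hc' : (m : ℤ) = A.card + B.card - 2 := by
    have : (A.card : ℤ) + B.card = m + 2 := by exact_mod_cast hc
    linarith
  have m1 := mul_nonneg (by linarith : (0 : ℤ) ≤ B.card - 1) (dd_nonneg G A)
  have m2 := mul_nonneg (by linarith : (0 : ℤ) ≤ A.card - 1) (dd_nonneg G B)
  have e1 : dd G univ = dd G A + dd G B := by rw [hu, dd_join hd ha]
  have e2 : ee G univ = ee G A + ee G B := by rw [hu, ee_join hd ha]
  constructor
  · rw [e1, e2, hc']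
    linarith
  · intro hT
    by_cases hB1 : B.card = 1
    · exact extract h m hm hcard hB1 hd hu ha hT
    by_cases hA1 : A.card = 1
    · exact extract h m hm hcard hA1 hd.symm (by rw [hu, Finset.union_comm])
        (fun p hp q hq => (ha q hq p hp).symm) hT
    exfalso
    have hA2 : (2 : ℤ) ≤ A.card := by have : 2 ≤ A.card := by omega
                                      exact_mod_cast this
    have hB2 : (2 : ℤ) ≤ B.card := by have : 2 ≤ B.card := by omega
                                      exact_mod_cast this
    rw [e1, e2, hc'] at hT
    have z1 : ((B.card : ℤ) - 1) * dd G A = 0 := by linarith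
    have z2 : dd G A = 0 := by
      rcases mul_eq_zero.1 z1 with h0 | h0
      · linarith
      · exact h0
    have z3 : DS G A = ∅ := by simpa [dd] using z2
    have z4 : ee G A = 0 := by simp [ee, z3]
    rw [z2, z4] at iA hT
    linarith

theorem mean_eq {V : Type*} [Fintype V] (G : SimpleGraph V) (n : ℕ) (hcard : Fintype.card V = n) :
    ((connSets G).card : ℤ) = 2 ^ n - 1 - dd G univ ∧
      ∑ S ∈ connSets G, 2 * (S.card : ℤ) = n * 2 ^ n - ee G univ := by
  classical
  have hmem : ∀ S, S ∈ connSets G ↔ S.Nonempty ∧ ¬ Splt G S := by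
    intro S
    simp only [connSets, Set.Finite.mem_toFinset, Set.mem_ofPred_eq]
    constructor
    · rintro ⟨h1, h2⟩; exact ⟨h1, (conn_iff G S h1).1 h2⟩
    · rintro ⟨h1, h2⟩; exact ⟨h1, (conn_iff G S h1).2 h2⟩
  have hne : ∅ ∉ DS G (univ : Finset V) := by
    intro h
    have := sep_two (mem_DS.1 h).2
    simp at this
  have hdis : Disjoint (connSets G) (insert ∅ (DS G univ)) := by
    rw [Finset.disjoint_left]
    intro S hS
    rw [hmem] at hS
    rw [Finset.mem_insert, mem_DS]
    rintro (rfl | h)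
    · simp at hS
    · exact hS.2 h.2
  have hun : (univ : Finset V).powerset = connSets G ∪ insert ∅ (DS G univ) := by
    ext S
    simp only [Finset.mem_powerset, Finset.subset_univ, true_iff, Finset.mem_union, hmem,
      Finset.mem_insert, mem_DS, true_and, Finset.nonempty_iff_ne_empty]
    tauto
  have key : ∀ f : Finset V → ℤ, ∑ S ∈ (univ : Finset V).powerset, f S =
      ∑ S ∈ connSets G, f S + (f ∅ + ∑ S ∈ DS G univ, f S) := by
    intro f
    rw [hun, Finset.sum_union hdis, Finset.sum_insert hne]
  have k1 := key (fun _ => 1)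
  have k2 := key (fun S => 2 * (S.card : ℤ))
  rw [sum_pow_one, Finset.card_univ, hcard] at k1
  rw [sum_pow_card, Finset.card_univ, hcard] at k2
  constructor
  · have : ((connSets G).card : ℤ) = ∑ S ∈ connSets G, 1 := by simp
    rw [this]
    unfold dd
    linarith
  · unfold ee
    simp only [Finset.card_empty] at k2
    push_cast at k2
    linarith

theorem stmt_2 {V : Type*} [Fintype V] (G : SimpleGraph V) (n : ℕ) (hn : 3 ≤ n)
    (hcard : Fintype.card V = n) (hcog : IsCograph G) (hconn : G.Connected) :
    globalMean G ≥ (n : ℝ) / 2 + 1 / (3 * 2 ^ (n - 2)) ∧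
      (globalMean G = (n : ℝ) / 2 + 1 / (3 * 2 ^ (n - 2)) ↔
        Nonempty (G ≃g skillet n)) := by
  classical
  have hP4 := noP4_of hcog
  obtain ⟨m, rfl⟩ : ∃ m, n = m + 2 := ⟨n - 2, by omega⟩
  have hm : 1 ≤ m := by omega
  have hne : (univ : Finset V).Nonempty := by
    rw [← Finset.card_pos, Finset.card_univ]; omega
  have hns : ¬ Splt G univ := by
    rw [← conn_iff G univ hne]
    rw [Finset.coe_univ]
    exact (SimpleGraph.induceUnivIso G).connected_iff.2 hconn
  obtain ⟨hN, hS⟩ := mean_eq G _ hcard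
  obtain ⟨hT, hT2⟩ := core hP4 m hm hcard hns
  rw [iso_iff G _ hn hcard]
  have hd0 := dd_nonneg G (univ : Finset V)
  have hNpos : 0 < (connSets G).card := by
    rw [Finset.card_pos]
    refine ⟨univ, ?_⟩
    simp only [connSets, Set.Finite.mem_toFinset, Set.mem_ofPred_eq]
    exact ⟨hne, (conn_iff G univ hne).2 hns⟩
  have hskc : ∀ c w, IsSk G c w → _ := fun c w h => sk_calc G m hcard h
  -- integer facts
  set T : ℤ := (m + 2 : ℤ) + (m + 2) * dd G univ - ee G univ with hTdef
  have hS' : ∑ S ∈ connSets G, 2 * (S.card : ℤ) = T + (m + 2) * ((connSets G).card : ℤ) := by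
    rw [hS, hN, hTdef]; push_cast; ring
  have h2m : (0 : ℤ) < 2 ^ m := by positivity
  have hN4 : ((connSets G).card : ℤ) = 4 * 2 ^ m - 1 - dd G univ := by
    rw [hN, pow_add]; ring
  have ineq : 2 * ((connSets G).card : ℤ) ≤ T * (3 * 2 ^ m) := by
    by_cases h2 : T = 2
    · rw [h2, hN4]; linarith [(hT2 h2).1]
    · have h3 : 3 ≤ T := by omega
      have := mul_le_mul_of_nonneg_right h3 (by linarith : (0 : ℤ) ≤ 3 * 2 ^ m)
      rw [hN4]; linarith
  have eqiff : 2 * ((connSets G).card : ℤ) = T * (3 * 2 ^ m) ↔ ∃ c w, IsSk G c w := by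
    constructor
    · intro heq
      by_cases h2 : T = 2
      · rw [h2, hN4] at heq
        exact (hT2 h2).2 (by linarith)
      · have h3 : 3 ≤ T := by omega
        have := mul_le_mul_of_nonneg_right h3 (by linarith : (0 : ℤ) ≤ 3 * 2 ^ m)
        rw [hN4] at heq; linarith
    · rintro ⟨c, w, h⟩
      obtain ⟨h1, h2⟩ := hskc c w h
      rw [hN4, h2, h1]; ring
  have hNR : (0 : ℝ) < (connSets G).card := by exact_mod_cast hNpos
  have hSR : 2 * ∑ S ∈ connSets G, (S.card : ℝ) = T + (m + 2) * ((connSets G).card : ℝ) := by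
    have : ((∑ S ∈ connSets G, 2 * (S.card : ℤ) : ℤ) : ℝ) =
      ((T + (m + 2) * ((connSets G).card : ℤ) : ℤ) : ℝ) := by rw [hS']
    push_cast at this
    rw [Finset.mul_sum]
    exact this
  have hpR : (0 : ℝ) < 3 * 2 ^ m := by positivity
  have hdiff : globalMean G - (((m + 2 : ℕ) : ℝ) / 2 + 1 / (3 * 2 ^ (m + 2 - 2))) =
      ((T : ℝ) * (3 * 2 ^ m) - 2 * ((connSets G).card : ℝ)) /
        (2 * ((connSets G).card : ℝ) * (3 * 2 ^ m)) := by
    have e : ∑ S ∈ connSets G, (S.card : ℝ) = (T + (m + 2) * ((connSets G).card : ℝ)) / 2 := by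
      linarith
    unfold globalMean
    rw [e, Nat.add_sub_cancel]
    push_cast
    field_simp
    ring
  have hden : (0 : ℝ) < 2 * ((connSets G).card : ℝ) * (3 * 2 ^ m) := by positivity
  constructor
  · have : (0 : ℝ) ≤ (T : ℝ) * (3 * 2 ^ m) - 2 * ((connSets G).card : ℝ) := by
      have : ((2 * ((connSets G).card : ℤ) : ℤ) : ℝ) ≤ ((T * (3 * 2 ^ m) : ℤ) : ℝ) := by
        exact_mod_cast ineq
      push_cast at this
      linarith
    have := div_nonneg this hden.le
    rw [← hdiff] at this
    linarith
  · rw [← sub_eq_zero, hdiff, div_eq_zero_iff, or_iff_left hden.ne', sub_eq_zero, ← eqiff]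
    constructor
    · intro h; exact_mod_cast h.symm
    · intro h; exact_mod_cast h.symm
end

section
/- Let G be a connected cograph of order n ≥ 1 and let v be any vertex of G. Then M_{G,v} ≥ (n+1)/2. -/
open SimpleGraph Finset

section helpers
open Classical

/-- `S` splits into two nonempty parts with no relation between. -/
def Dis {V : Type*} (R : V → V → Prop) (S : Finset V) : Prop :=
  ∃ A B : Finset V, A.Nonempty ∧ B.Nonempty ∧ Disjoint A B ∧ A ∪ B = S ∧
    ∀ a ∈ A, ∀ b ∈ B, ¬ R a b

/-- no induced P4 -/
def P4F {V : Type*} (G : SimpleGraph V) : Prop :=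
  ∀ a b c d, G.Adj a b → G.Adj b c → G.Adj c d → ¬ G.Adj a c → ¬ G.Adj a d → ¬ G.Adj b d → False

lemma p4f_of_cograph {V : Type*} {G : SimpleGraph V} (h : IsCograph G) : P4F G := by
  intro a b c d hab hbc hcd hac had hbd
  have nac : a ≠ c := by rintro rfl; exact had hcd
  have nad : a ≠ d := by rintro rfl; exact hac hcd.symm
  have nbd : b ≠ d := by rintro rfl; exact had hab
  have := hab.ne; have := hbc.ne; have := hcd.ne
  refine h.false ⟨⟨![a, b, c, d], ?_⟩, ?_⟩
  · intro i j hij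
    fin_cases i <;> fin_cases j <;> simp_all
  · intro i j
    have h1 := hab.symm; have h2 := hbc.symm; have h3 := hcd.symm
    have h4 := fun h => hac (SimpleGraph.Adj.symm h)
    have h5 := fun h => had (SimpleGraph.Adj.symm h)
    have h6 := fun h => hbd (SimpleGraph.Adj.symm h)
    fin_cases i <;> fin_cases j <;> simp_all [SimpleGraph.pathGraph_adj] <;> assumption

lemma p4f_compl {V : Type*} {G : SimpleGraph V} (h : P4F G) : P4F Gᶜ := by
  intro a b c d hab hbc hcd hac had hbd
  have nac : a ≠ c := by rintro rfl; exact had hcd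
  have nad : a ≠ d := by rintro rfl; exact hac hcd.symm
  have nbd : b ≠ d := by rintro rfl; exact had hab
  simp only [SimpleGraph.compl_adj, not_and, not_not] at *
  exact h b d a c (hbd nbd) (had nad).symm (hac nac) (fun h => hab.2 h.symm) hbc.2
    (fun h => hcd.2 h.symm)

lemma split_step_s3 {V : Type*} {G : SimpleGraph V} (h : P4F G) (x : V) (U : Finset V)
    (hx : x ∉ U) (hU : Dis G.Adj U) :
    Dis G.Adj (insert x U) ∨ Dis Gᶜ.Adj (insert x U) := by
  have key : ∀ A B : Finset V, A.Nonempty → B.Nonempty → Disjoint A B → A ∪ B = U →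
      (∀ a ∈ A, ∀ b ∈ B, ¬ G.Adj a b) → (∃ y ∈ A, ¬ G.Adj x y) → (∃ b ∈ B, G.Adj x b) →
      Dis G.Adj (insert x U) := by
    rintro A B hA hB hd rfl hn ⟨y, hy, hxy⟩ ⟨b, hb, hxb⟩
    refine ⟨A.filter (fun z => ¬ G.Adj x z), insert x (A.filter (fun z => G.Adj x z) ∪ B),
      ⟨y, by simp [hy, hxy]⟩, ⟨x, by simp⟩, ?_, ?_, ?_⟩
    · rw [Finset.disjoint_left] at *
      intro z
      simp only [Finset.mem_filter, Finset.mem_insert, Finset.mem_union] at *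
      rintro ⟨h1, h2⟩ (rfl | h3 | h3)
      · tauto
      · tauto
      · exact hd h1 h3
    · ext z
      simp only [Finset.mem_filter, Finset.mem_insert, Finset.mem_union] at *
      tauto
    · intro p hp q hq
      simp only [Finset.mem_filter, Finset.mem_insert, Finset.mem_union] at *
      rcases hq with rfl | hq | hq
      · exact fun h => hp.2 h.symm
      · intro hpq
        exact h b x q p hxb.symm hq.2 hpq.symm (fun h => hn q hq.1 b hb h.symm)
          (fun h => hn p hp.1 b hb h.symm) hp.2
      · exact hn p hp.1 q hq
  obtain ⟨A, B, hA, hB, hd, hAB, hn⟩ := hU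
  have triv : ∀ A B : Finset V, A.Nonempty → Disjoint A B → A ∪ B = U →
      (∀ a ∈ A, ∀ b ∈ B, ¬ G.Adj a b) → (¬ ∃ b ∈ A, G.Adj x b) →
      Dis G.Adj (insert x U) := by
    rintro A B hA hd rfl hn hne
    refine ⟨A, insert x B, hA, ⟨x, by simp⟩, ?_, ?_, ?_⟩
    · rw [Finset.disjoint_insert_right]
      exact ⟨fun h => hx (by simp [h]), hd⟩
    · ext z; simp
    · intro a ha b hb hab
      rcases Finset.mem_insert.1 hb with rfl | hb
      · exact hne ⟨a, ha, hab.symm⟩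
      · exact hn a ha b hb hab
  have hn' : ∀ b ∈ B, ∀ a ∈ A, ¬ G.Adj b a := fun b hb a ha h => hn a ha b hb h.symm
  have hBA : B ∪ A = U := by rw [Finset.union_comm, hAB]
  by_cases h1 : ∃ b ∈ A, G.Adj x b
  swap
  · exact Or.inl (triv A B hA hd hAB hn h1)
  by_cases h2 : ∃ b ∈ B, G.Adj x b
  swap
  · exact Or.inl (triv B A hB hd.symm hBA hn' h2)
  by_cases h3 : ∃ y ∈ A, ¬ G.Adj x y
  · exact Or.inl (key A B hA hB hd hAB hn h3 h2)
  by_cases h4 : ∃ y ∈ B, ¬ G.Adj x y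
  · exact Or.inl (key B A hB hA hd.symm hBA hn' h4 h1)
  push Not at h3 h4
  right
  refine ⟨{x}, U, by simp, ?_, by simpa using hx, by ext; simp, ?_⟩
  · rw [← hAB]; exact hA.mono Finset.subset_union_left
  · intro a ha b hb hab
    rw [Finset.mem_singleton] at ha
    subst ha
    rw [← hAB, Finset.mem_union] at hb
    exact hab.2 (hb.elim (h3 b) (h4 b))

lemma split_thm {V : Type*} {G : SimpleGraph V} (h : P4F G) (U : Finset V) (hU : 2 ≤ U.card) :
    Dis G.Adj U ∨ Dis Gᶜ.Adj U := by
  induction U using Finset.induction_on with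
  | empty => simp at hU
  | insert x U hx ih =>
    by_cases hc : 2 ≤ U.card
    · rcases ih hc with h1 | h1
      · exact split_step_s3 h x U hx h1
      · have := split_step_s3 (p4f_compl h) x U hx h1
        rw [compl_compl] at this
        exact this.symm
    · rw [Finset.card_insert_of_notMem hx] at hU
      have : U.card = 1 := by omega
      obtain ⟨y, rfl⟩ := Finset.card_eq_one.1 this
      have hxy : x ≠ y := by simpa using hx
      by_cases ha : G.Adj x y
      · right
        exact ⟨{x}, {y}, by simp, by simp, by simpa using hxy, rfl, by simp [ha]⟩
      · left
        exact ⟨{x}, {y}, by simp, by simp, by simpa using hxy, rfl, by simp [ha]⟩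

lemma sum_pow {V : Type*} (B : Finset V) : ∀ k : ℤ,
    ∑ T ∈ B.powerset, (2 * (T.card : ℤ) + k) = (B.card + k) * 2 ^ B.card := by
  induction B using Finset.induction_on with
  | empty => intro k; simp
  | insert x B hx ih =>
    intro k
    rw [Finset.sum_powerset_insert hx, ih k, Finset.card_insert_of_notMem hx]
    have : ∑ T ∈ B.powerset, (2 * ((insert x T).card : ℤ) + k)
        = ∑ T ∈ B.powerset, (2 * (T.card : ℤ) + (k + 2)) := by
      refine Finset.sum_congr rfl fun T hT => ?_
      rw [Finset.card_insert_of_notMem (fun h => hx (Finset.mem_powerset.1 hT h))]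
      push_cast; ring
    rw [this, ih]
    push_cast
    ring

lemma sum_loc {V : Type*} (A : Finset V) (v : V) (hv : v ∈ A) (n : ℤ) :
    ∑ T ∈ A.powerset with v ∈ T, (2 * (T.card : ℤ) - (n + 1))
      = (A.card - n) * 2 ^ (A.card - 1) := by
  obtain ⟨B, hvB, rfl⟩ : ∃ B, v ∉ B ∧ insert v B = A :=
    ⟨A.erase v, by simp, Finset.insert_erase hv⟩
  rw [Finset.sum_filter, Finset.sum_powerset_insert hvB, Finset.card_insert_of_notMem hvB]
  have h1 : ∑ T ∈ B.powerset, (if v ∈ T then (2 * (T.card : ℤ) - (n + 1)) else 0) = 0 := by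
    refine Finset.sum_eq_zero fun T hT => ?_
    rw [if_neg (fun h => hvB (Finset.mem_powerset.1 hT h))]
  have h2 : ∑ T ∈ B.powerset,
      (if v ∈ insert v T then (2 * ((insert v T).card : ℤ) - (n + 1)) else 0)
      = ∑ T ∈ B.powerset, (2 * (T.card : ℤ) + (1 - n)) := by
    refine Finset.sum_congr rfl fun T hT => ?_
    rw [if_pos (by simp),
      Finset.card_insert_of_notMem (fun h => hvB (Finset.mem_powerset.1 hT h))]
    push_cast; ring
  rw [h1, h2, sum_pow]
  simp
  ring

lemma arith (c d m : ℕ) (hm : 1 ≤ m) : m + d ≤ m * 2 ^ d := by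
  have : d + 1 ≤ 2 ^ d := Nat.lt_two_pow_self
  nlinarith

lemma Dis.with_mem {V : Type*} {G : SimpleGraph V} {U : Finset V} (h : Dis G.Adj U) {v : V}
    (hv : v ∈ U) : ∃ A, A ⊆ U ∧ v ∈ A ∧ (U \ A).Nonempty ∧
      ∀ a ∈ A, ∀ b ∈ U, b ∉ A → ¬ G.Adj a b := by
  obtain ⟨A, B, hA, hB, hd, rfl, hn⟩ := h
  rw [Finset.disjoint_left] at hd
  rcases Finset.mem_union.1 hv with h | h
  · refine ⟨A, Finset.subset_union_left, h, ?_, ?_⟩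
    · obtain ⟨b, hb⟩ := hB
      exact ⟨b, by simp [hb]; exact fun h => hd h hb⟩
    · intro a ha b hb hbA
      exact hn a ha b ((Finset.mem_union.1 hb).resolve_left hbA)
  · refine ⟨B, Finset.subset_union_right, h, ?_, ?_⟩
    · obtain ⟨b, hb⟩ := hA
      exact ⟨b, by simp [hb]; exact fun h => hd hb h⟩
    · intro a ha b hb hbA hab
      exact hn b ((Finset.mem_union.1 hb).resolve_right hbA) a ha hab.symm

lemma main_ineq {V : Type*} {G : SimpleGraph V} (h : P4F G) (v : V) : ∀ (n : ℕ) (U : Finset V),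
    U.card = n → v ∈ U → ¬ Dis G.Adj U →
    ∑ T ∈ U.powerset with v ∈ T ∧ Dis G.Adj T, (2 * (T.card : ℤ) - (n + 1)) ≤ 0 := by
  intro n
  induction n using Nat.strong_induction_on with
  | _ n ih =>
  intro U hUn hv hU
  by_cases hc : 2 ≤ U.card
  swap
  · refine Finset.sum_nonpos fun T hT => ?_
    simp only [Finset.mem_filter, Finset.mem_powerset] at hT
    have := Finset.card_le_card hT.1
    omega
  obtain ⟨A, hAU, hvA, hne, hjoin⟩ := ((split_thm h U hc).resolve_left hU).with_mem hv
  replace hjoin : ∀ a ∈ A, ∀ b ∈ U, b ∉ A → G.Adj a b := by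
    intro a ha b hb hbA
    have := hjoin a ha b hb hbA
    simp only [SimpleGraph.compl_adj, not_and, not_not] at this
    exact this (by rintro rfl; exact hbA ha)
  -- component
  let P : Finset V → Prop := fun C => C ⊆ A ∧ v ∈ C ∧ ∀ a ∈ C, ∀ b ∈ A, b ∉ C → ¬ G.Adj a b
  have hex : ∃ k, ∃ C, P C ∧ C.card = k :=
    ⟨A.card, A, ⟨subset_rfl, hvA, fun a _ b hb hb' => absurd hb hb'⟩, rfl⟩
  obtain ⟨C, ⟨hCA, hvC, hCsep⟩, hCk⟩ := Nat.find_spec hex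
  have hmin : ∀ C', P C' → C.card ≤ C'.card := by
    intro C' hC'
    rw [hCk]
    exact Nat.find_min' hex ⟨C', hC', rfl⟩
  have hCconn : ¬ Dis G.Adj C := by
    intro hD
    obtain ⟨X, hXC, hvX, hne', hX⟩ := hD.with_mem hvC
    have h1 : C.card ≤ X.card := hmin X ⟨hXC.trans hCA, hvX, by
      intro a ha b hb hbX
      by_cases hbC : b ∈ C
      · exact hX a ha b hbC hbX
      · exact hCsep a (hXC ha) b hb hbC⟩
    have := Finset.eq_of_subset_of_card_le hXC h1
    subst this
    simp at hne'
  have hAcard : A.card < n := by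
    rw [← hUn]
    apply Finset.card_lt_card
    refine ⟨hAU, fun hUA => ?_⟩
    rw [Finset.sdiff_eq_empty_iff_subset.2 hUA] at hne
    simp at hne
  have hCcard : C.card ≤ A.card := Finset.card_le_card hCA
  have hCpos : 0 < C.card := Finset.card_pos.2 ⟨v, hvC⟩
  have hsub : ∀ T ⊆ U, v ∈ T → Dis G.Adj T → T ⊆ A := by
    intro T hTU hvT hD b hb
    by_contra hbA
    obtain ⟨X, hXT, hvX, ⟨y, hy⟩, hX⟩ := hD.with_mem hvT
    rw [Finset.mem_sdiff] at hy
    by_cases hbX : b ∈ X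
    · by_cases hyA : y ∈ A
      · exact hX b hbX y hy.1 hy.2 (hjoin y hyA b (hTU hb) hbA).symm
      · exact hX v hvX y hy.1 hy.2 (hjoin v hvA y (hTU hy.1) hyA)
    · exact hX v hvX b hb hbX (hjoin v hvA b (hTU hb) hbA)
  have hdis : ∀ T ⊆ A, v ∈ T → ¬ T ⊆ C → Dis G.Adj T := by
    intro T hTA hvT hTC
    refine ⟨T ∩ C, T \ C, ⟨v, by simp [hvT, hvC]⟩, ?_, ?_, ?_, ?_⟩
    · rwa [Finset.sdiff_nonempty]
    · rw [Finset.disjoint_left]; intro x hx hx'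
      simp at hx hx'; tauto
    · ext x; simp; tauto
    · intro a ha b hb
      rw [Finset.mem_inter] at ha
      rw [Finset.mem_sdiff] at hb
      exact hCsep a ha.2 b (hTA hb.1) hb.2
  have hsplit : ({T ∈ U.powerset | v ∈ T ∧ Dis G.Adj T}) =
      {T ∈ C.powerset | v ∈ T ∧ Dis G.Adj T} ∪
        ({T ∈ A.powerset | v ∈ T} \ {T ∈ C.powerset | v ∈ T}) := by
    ext T
    simp only [Finset.mem_filter, Finset.mem_powerset, Finset.mem_union, Finset.mem_sdiff]
    constructor
    · rintro ⟨h1, h2, h3⟩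
      have := hsub T h1 h2 h3
      tauto
    · rintro (⟨h1, h2, h3⟩ | ⟨⟨h1, h2⟩, h3⟩)
      · exact ⟨h1.trans (hCA.trans hAU), h2, h3⟩
      · exact ⟨h1.trans hAU, h2, hdis T h1 h2 (fun h => h3 ⟨h, h2⟩)⟩
  rw [hsplit, Finset.sum_union]
  swap
  · rw [Finset.disjoint_left]
    intro T
    simp only [Finset.mem_filter, Finset.mem_sdiff]
    tauto
  have hss : ({T ∈ C.powerset | v ∈ T}) ⊆ {T ∈ A.powerset | v ∈ T} := by
    intro T
    simp only [Finset.mem_filter, Finset.mem_powerset]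
    rintro ⟨h1, h2⟩
    exact ⟨h1.trans hCA, h2⟩
  have e1 := Finset.sum_sdiff (f := fun T : Finset V => (2 * (T.card : ℤ) - (n + 1))) hss
  rw [sum_loc A v hvA, sum_loc C v hvC] at e1
  have e2 := ih C.card (by omega) C rfl hvC hCconn
  have e3 : ∑ T ∈ C.powerset with v ∈ T ∧ Dis G.Adj T, (2 * (T.card : ℤ) - (n + 1)) ≤
      ∑ T ∈ C.powerset with v ∈ T ∧ Dis G.Adj T, (2 * (T.card : ℤ) - (C.card + 1)) := by
    refine Finset.sum_le_sum fun T _ => ?_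
    omega
  obtain ⟨d, hd⟩ := Nat.exists_eq_add_of_le hCcard
  obtain ⟨m, hm⟩ := Nat.exists_eq_add_of_le hAcard.le
  have hm1 : 1 ≤ m := by omega
  have e4 : ((A.card : ℤ) - n) * 2 ^ (A.card - 1) ≤ (C.card - n) * 2 ^ (C.card - 1) := by
    have ha := arith 0 d m hm1
    have ha' : (m : ℤ) + d ≤ m * 2 ^ d := by exact_mod_cast ha
    have : A.card - 1 = d + (C.card - 1) := by omega
    rw [this, pow_add, ← mul_assoc]
    refine mul_le_mul_of_nonneg_right ?_ (by positivity)
    have h1 : (A.card : ℤ) - n = - m := by omega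
    have h2 : (C.card : ℤ) - n = - (m + d) := by omega
    rw [h1, h2]
    linarith
  linarith

lemma conn_of_not_dis {V : Type*} [Fintype V] {G : SimpleGraph V} {S : Finset V} {v : V}
    (hv : v ∈ S) : (G.induce (S : Set V)).Connected ↔ ¬ Dis G.Adj S := by
  constructor
  · intro hc hD
    obtain ⟨A, hAS, hvA, ⟨y, hy⟩, hA⟩ := hD.with_mem hv
    rw [Finset.mem_sdiff] at hy
    have key : ∀ a b : (S : Set V), (G.induce (S : Set V)).Reachable a b →
        a.1 ∈ A → b.1 ∈ A := by
      rintro a b ⟨w⟩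
      induction w with
      | nil => exact id
      | cons hadj _ ih =>
        intro ha
        apply ih
        by_contra hb
        exact hA _ ha _ (by simpa using Subtype.prop _) hb hadj
    exact hy.2 (key ⟨v, hv⟩ ⟨y, hy.1⟩ (hc.preconnected _ _) hvA)
  · intro hD
    rw [SimpleGraph.connected_iff_exists_forall_reachable]
    refine ⟨⟨v, hv⟩, ?_⟩
    by_contra! hno
    obtain ⟨w, hw⟩ := hno
    apply hD
    let X : Finset V :=
      S.filter (fun x => ∃ hx : x ∈ S, (G.induce (S : Set V)).Reachable ⟨v, hv⟩ ⟨x, hx⟩)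
    refine ⟨X, S \ X, ⟨v, ?_⟩, ⟨w.1, ?_⟩, Finset.disjoint_sdiff, ?_, ?_⟩
    · exact Finset.mem_filter.2 ⟨hv, hv, SimpleGraph.Reachable.refl _⟩
    · refine Finset.mem_sdiff.2 ⟨w.2, fun h => ?_⟩
      obtain ⟨_, _, h3⟩ := Finset.mem_filter.1 h
      exact hw h3
    · exact Finset.union_sdiff_of_subset (Finset.filter_subset _ _)
    · intro a ha b hb hab
      obtain ⟨_, ha2, ha3⟩ := Finset.mem_filter.1 ha
      rw [Finset.mem_sdiff] at hb
      refine hb.2 (Finset.mem_filter.2 ⟨hb.1, hb.1, ha3.trans ?_⟩)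
      exact SimpleGraph.Adj.reachable (by simpa using hab)

lemma final_int {V : Type*} [Fintype V] {G : SimpleGraph V} (hcog : IsCograph G)
    (hconn : G.Connected) (v : V) :
    0 ≤ ∑ S ∈ localSets G v, (2 * (S.card : ℤ) - (Fintype.card V + 1)) := by
  have hU : ¬ Dis G.Adj (Finset.univ : Finset V) := by
    rw [← conn_of_not_dis (Finset.mem_univ v)]
    rw [Finset.coe_univ]
    exact (SimpleGraph.induceUnivIso G).connected_iff.2 hconn
  have h1 := main_ineq (p4f_of_cograph hcog) v (Fintype.card V) Finset.univ rfl
    (Finset.mem_univ v) hU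
  have h2 := sum_loc (Finset.univ : Finset V) v (Finset.mem_univ v) (Fintype.card V)
  rw [Finset.card_univ, sub_self, zero_mul,
    ← Finset.sum_filter_add_sum_filter_not _ (fun T => Dis G.Adj T), Finset.filter_filter,
    Finset.filter_filter] at h2
  have h3 : localSets G v = {T ∈ (Finset.univ : Finset V).powerset | v ∈ T ∧ ¬ Dis G.Adj T} := by
    ext T
    simp only [localSets, Set.Finite.mem_toFinset, Set.mem_setOf_eq, Finset.mem_filter,
      Finset.mem_powerset, Finset.subset_univ, true_and]
    exact and_congr_right fun hv => conn_of_not_dis hv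
  rw [h3]
  linarith

end helpers

theorem stmt_3 {V : Type*} [Fintype V] (G : SimpleGraph V) (n : ℕ) (hn : 1 ≤ n)
    (hcard : Fintype.card V = n) (hcog : IsCograph G) (hconn : G.Connected) (v : V) :
    localMean G v ≥ ((n : ℝ) + 1) / 2 := by
  have h := final_int hcog hconn v
  have h' : (0 : ℝ) ≤ ∑ S ∈ localSets G v, (2 * (S.card : ℝ) - (Fintype.card V + 1)) := by
    exact_mod_cast h
  rw [Finset.sum_sub_distrib, ← Finset.mul_sum, Finset.sum_const, nsmul_eq_mul, hcard] at h'
  have hne : (localSets G v).Nonempty := by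
    refine ⟨Finset.univ, ?_⟩
    simp only [localSets, Set.Finite.mem_toFinset, Set.mem_setOf_eq, Finset.mem_univ, true_and]
    rw [Finset.coe_univ]
    exact (SimpleGraph.induceUnivIso G).connected_iff.2 hconn
  have hpos : (0 : ℝ) < (localSets G v).card := by exact_mod_cast Finset.card_pos.2 hne
  rw [localMean, ge_iff_le, le_div_iff₀ hpos]
  linarith
end

section
/- For every n ≥ 4 and every s with 1 ≤ s ≤ ⌊n/2⌋ − 1, we have M*_{K_{s,n−s}} > M*_{K_{s+1,n−s−1}}. In particular, for every n ≥ 1 the star K_{1,n−1} has maximum M* mean among all complete bipartite graphs of order n. -/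
open SimpleGraph Finset

theorem aux_conn {α β : Type*} (S : Finset (α ⊕ β)) :
    (2 ≤ S.card ∧ ((completeBipartiteGraph α β).induce (S : Set (α ⊕ β))).Connected) ↔
      (S.toLeft.Nonempty ∧ S.toRight.Nonempty) := by
  constructor
  · rintro ⟨h2, hc⟩
    have hnt : Nontrivial (S : Set (α ⊕ β)) := by
      have : (S : Set (α ⊕ β)).Nontrivial := by
        exact_mod_cast Finset.one_lt_card_iff_nontrivial.mp h2
      exact Set.nontrivial_coe_sort.mpr this
    obtain ⟨x⟩ := hc.nonempty
    obtain ⟨y, hy⟩ := hc.preconnected.exists_adj_of_nontrivial x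
    obtain ⟨x, hx⟩ := x
    obtain ⟨y, hyS⟩ := y
    simp only [SimpleGraph.comap_adj, Function.Embedding.subtype_apply] at hy
    cases x <;> cases y <;> simp at hy
    · exact ⟨⟨_, Finset.mem_toLeft.mpr hx⟩, ⟨_, Finset.mem_toRight.mpr hyS⟩⟩
    · exact ⟨⟨_, Finset.mem_toLeft.mpr hyS⟩, ⟨_, Finset.mem_toRight.mpr hx⟩⟩
  · rintro ⟨⟨a, ha⟩, ⟨b, hb⟩⟩
    rw [Finset.mem_toLeft] at ha
    rw [Finset.mem_toRight] at hb
    refine ⟨Finset.one_lt_card.mpr ⟨_, ha, _, hb, by simp⟩, ?_⟩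
    have key : ∀ z : (S : Set (α ⊕ β)),
        ((completeBipartiteGraph α β).induce (S : Set (α ⊕ β))).Reachable ⟨Sum.inl a, ha⟩ z := by
      have hab : ((completeBipartiteGraph α β).induce (S : Set (α ⊕ β))).Adj
          ⟨Sum.inl a, ha⟩ ⟨Sum.inr b, hb⟩ := by simp
      rintro ⟨z | z, hz⟩
      · refine hab.reachable.trans (SimpleGraph.Adj.reachable ?_)
        simp
      · refine (SimpleGraph.Adj.reachable ?_)
        simp
    have : Nonempty (S : Set (α ⊕ β)) := ⟨⟨Sum.inl a, ha⟩⟩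
    exact ⟨fun u v => (key u).symm.trans (key v)⟩

theorem aux_sum {s t : ℕ} (F : Finset (Fin s ⊕ Fin t) → ℝ) :
    ∑ S ∈ mstarSets (completeBipartiteGraph (Fin s) (Fin t)), F S =
      ∑ A ∈ (univ : Finset (Finset (Fin s))).filter (·.Nonempty),
        ∑ B ∈ (univ : Finset (Finset (Fin t))).filter (·.Nonempty), F (A.disjSum B) := by
  rw [← Finset.sum_product']
  refine Finset.sum_bij' (fun S _ => (S.toLeft, S.toRight)) (fun p _ => p.1.disjSum p.2) ?_ ?_ ?_ ?_ ?_
  · intro S hS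
    simp only [mstarSets, Set.Finite.mem_toFinset, Set.mem_ofPred_eq] at hS
    simpa using (aux_conn S).mp hS
  · intro p hp
    simp only [mstarSets, Set.Finite.mem_toFinset, Set.mem_ofPred_eq]
    apply (aux_conn _).mpr
    simpa using hp
  · intro S _
    simp [Finset.toLeft_disjSum_toRight]
  · intro p _
    simp
  · intro S _
    simp [Finset.toLeft_disjSum_toRight]

theorem aux_card (s : ℕ) :
    (((univ : Finset (Finset (Fin s))).filter (·.Nonempty)).card : ℝ) = 2 ^ s - 1 := by
  have h : (univ : Finset (Finset (Fin s))).filter (·.Nonempty) = univ.erase ∅ := by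
    ext A; simp [Finset.nonempty_iff_ne_empty]
  rw [h, Finset.card_erase_of_mem (by simp), Finset.card_univ, Fintype.card_finset, Fintype.card_fin,
    Nat.cast_sub Nat.one_le_two_pow]
  simp

theorem aux_sumcard (s : ℕ) :
    ∑ A ∈ (univ : Finset (Finset (Fin s))).filter (·.Nonempty), (A.card : ℝ) = s * 2 ^ s / 2 := by
  rw [Finset.sum_filter]
  have h1 : ∀ A : Finset (Fin s), (if A.Nonempty then (A.card : ℝ) else 0) = A.card := by
    intro A
    split_ifs with h
    · rfl
    · simp [Finset.not_nonempty_iff_eq_empty.mp h]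
  simp only [h1]
  have h2 : ∑ A : Finset (Fin s), (A.card : ℝ) = ∑ A : Finset (Fin s), ((s : ℝ) - A.card) := by
    rw [← Equiv.sum_comp (compl_involutive (α := Finset (Fin s))).toPerm]
    refine Finset.sum_congr rfl fun A _ => ?_
    have := Finset.card_add_card_compl A
    rw [Fintype.card_fin] at this
    have h : (A.card : ℝ) + (Aᶜ.card : ℝ) = s := by exact_mod_cast this
    simp only [Function.Involutive.coe_toPerm]
    linarith
  rw [Finset.sum_sub_distrib] at h2
  simp only [Finset.sum_const, Finset.card_univ, Fintype.card_finset, Fintype.card_fin,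
    nsmul_eq_mul] at h2
  push_cast at h2
  linarith

noncomputable def auxg (s : ℕ) : ℝ := s / (2 ^ s - 1)

theorem aux_mean (s t : ℕ) (hs : 1 ≤ s) (ht : 1 ≤ t) :
    mstarMean (completeBipartiteGraph (Fin s) (Fin t)) = ((s + t : ℕ) + auxg s + auxg t) / 2 := by
  have hc : ((mstarSets (completeBipartiteGraph (Fin s) (Fin t))).card : ℝ)
      = (2 ^ s - 1) * (2 ^ t - 1) := by
    have := aux_sum (s := s) (t := t) (fun _ => 1)
    simp only [Finset.sum_const, nsmul_eq_mul, mul_one, aux_card] at this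
    exact this
  have hS : ∑ S ∈ mstarSets (completeBipartiteGraph (Fin s) (Fin t)), (S.card : ℝ)
      = (2 ^ t - 1) * (s * 2 ^ s / 2) + (2 ^ s - 1) * (t * 2 ^ t / 2) := by
    rw [aux_sum]
    simp only [Finset.card_disjSum, Nat.cast_add, Finset.sum_add_distrib, Finset.sum_const,
      nsmul_eq_mul, aux_card, aux_sumcard, ← Finset.mul_sum]
  have h1 : (2 : ℝ) ^ s - 1 ≠ 0 := by
    have : (1 : ℝ) < 2 ^ s := one_lt_pow₀ (by norm_num) (by omega)
    linarith
  have h2 : (2 : ℝ) ^ t - 1 ≠ 0 := by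
    have : (1 : ℝ) < 2 ^ t := one_lt_pow₀ (by norm_num) (by omega)
    linarith
  rw [mstarMean, hc, hS, auxg, auxg]
  push_cast
  field_simp
  ring

theorem aux_conv (s : ℕ) (hs : 1 ≤ s) :
    auxg (s + 1) - auxg (s + 2) < auxg s - auxg (s + 1) := by
  unfold auxg
  have hx : (2 : ℝ) ≤ 2 ^ s := by
    calc (2 : ℝ) = 2 ^ 1 := by norm_num
      _ ≤ 2 ^ s := pow_le_pow_right₀ (by norm_num) hs
  have hpos : 0 < (s : ℝ) * (2 * 2 ^ s + 1) - 4 * 2 ^ s + 4 := by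
    rcases Nat.lt_or_ge s 2 with h | h
    · obtain rfl : s = 1 := by omega
      norm_num
    · have : (2 : ℝ) ≤ s := by exact_mod_cast h
      nlinarith
  rw [pow_add, pow_add]
  generalize (2 : ℝ) ^ s = x at *
  push_cast
  rw [← sub_pos]
  have h1 : x - 1 ≠ 0 := by linarith
  have h2 : x * 2 ^ 1 - 1 ≠ 0 := by linarith
  have h3 : x * 2 ^ 2 - 1 ≠ 0 := by linarith
  have e : (s : ℝ) / (x - 1) - (s + 1) / (x * 2 ^ 1 - 1) -
      ((s + 1) / (x * 2 ^ 1 - 1) - (s + 2) / (x * 2 ^ 2 - 1)) =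
      x * (s * (2 * x + 1) - 4 * x + 4) / ((x - 1) * (x * 2 ^ 1 - 1) * (x * 2 ^ 2 - 1)) := by
    rw [div_sub_div _ _ h1 h2, div_sub_div _ _ h2 h3,
      div_sub_div _ _ (mul_ne_zero h1 h2) (mul_ne_zero h2 h3),
      div_eq_div_iff (mul_ne_zero (mul_ne_zero h1 h2) (mul_ne_zero h2 h3))
        (mul_ne_zero (mul_ne_zero h1 h2) h3)]
    ring
  rw [e]
  have p1 : 0 < x - 1 := by linarith
  have p2 : 0 < x * 2 ^ 1 - 1 := by linarith
  have p3 : 0 < x * 2 ^ 2 - 1 := by linarith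
  have p4 : 0 < x := by linarith
  exact div_pos (mul_pos p4 hpos) (mul_pos (mul_pos p1 p2) p3)

theorem aux_anti (s k : ℕ) (hs : 1 ≤ s) :
    auxg (s + k) - auxg (s + k + 1) ≤ auxg s - auxg (s + 1) := by
  induction k with
  | zero => simp
  | succ k ih => exact (aux_conv (s + k) (by omega)).le.trans ih

theorem aux_super (a b : ℕ) :
    auxg (a + 1) + auxg (b + 1) ≤ auxg 1 + auxg (a + b + 1) := by
  induction a with
  | zero => simp
  | succ a ih =>
    have h := aux_anti (a + 1) b (by omega)
    rw [show a + 1 + b = a + b + 1 by ring] at h ⊢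
    linarith

theorem stmt_5 :
    (∀ n s : ℕ, 4 ≤ n → 1 ≤ s → s ≤ n / 2 - 1 →
      mstarMean (completeBipartiteGraph (Fin s) (Fin (n - s))) >
        mstarMean (completeBipartiteGraph (Fin (s + 1)) (Fin (n - s - 1)))) ∧
    (∀ n s : ℕ, 1 ≤ n → 1 ≤ s → s ≤ n - 1 →
      mstarMean (completeBipartiteGraph (Fin s) (Fin (n - s))) ≤
        mstarMean (completeBipartiteGraph (Fin 1) (Fin (n - 1)))) := by
  constructor
  · intro n s hn hs hsn
    obtain ⟨k, rfl⟩ : ∃ k, n = s + (s + 1 + k + 1) := ⟨n - (s + (s + 1 + 1)), by omega⟩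
    rw [Nat.add_sub_cancel_left, Nat.add_sub_cancel, aux_mean _ _ hs (by omega),
      aux_mean _ _ (by omega) (by omega),
      show s + 1 + (s + 1 + k) = s + (s + 1 + k + 1) by ring]
    have h1 := aux_anti (s + 1) k (by omega)
    have h2 := aux_conv s hs
    rw [show s + 1 + 1 = s + 2 by ring] at h1
    linarith
  · intro n s hn hs hsn
    obtain ⟨a, rfl⟩ : ∃ a, s = a + 1 := ⟨s - 1, by omega⟩
    obtain ⟨b, rfl⟩ : ∃ b, n = (a + 1) + (b + 1) := ⟨n - (a + 2), by omega⟩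
    rw [Nat.add_sub_cancel_left, show a + 1 + (b + 1) - 1 = a + b + 1 by omega,
      aux_mean _ _ hs (by omega), aux_mean _ _ (by omega) (by omega),
      show 1 + (a + b + 1) = a + 1 + (b + 1) by ring]
    have := aux_super a b
    linarith
end
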